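/- arXiv:2111.15586 — 5 statements merged into one kernel-verified Lean document; each statement's English description precedes it below -/
import Mathlib

section
/- Let H be a finite abelian group and let G be an order controllable group shift over H. Then there exists a noncatastrophic isomorphic encoder for G; that is, there exist a finite abelian group K and a topological group isomorphism Φ : K^ℤ → G such that σ ∘ Φ = Φ ∘ σ and Φ maps the subgroup K^(ℤ) of finitely supported sequences onto G_f. In particular, G is algebraically and topologically conjugate to the full group shift K^ℤ. -/
open Function Topology

/-- The backward shift by `n`: `(shiftPow n x) i = x (i + n)`. -/
def shiftPow {H : Type*} (n : ℤ) (x : ℤ → H) : ℤ → H := fun i => x (i + n)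

/-- The backward shift operator `σ`: `(shift x) i = x (i + 1)`. -/
abbrev shift {H : Type*} (x : ℤ → H) : ℤ → H := shiftPow 1 x

/-- A group shift over `H`: a closed, shift-invariant subgroup of the full shift `H^ℤ`. -/
def IsGroupShift {H : Type*} [AddCommGroup H] [TopologicalSpace H]
    (G : AddSubgroup (ℤ → H)) : Prop :=
  IsClosed (G : Set (ℤ → H)) ∧ shift '' (G : Set (ℤ → H)) = (G : Set (ℤ → H))

/-- `G_f`: the set of finitely supported elements of `G`. -/
def finSupp {H : Type*} [AddCommGroup H] (G : AddSubgroup (ℤ → H)) : Set (ℤ → H) :=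
  {x | x ∈ G ∧ (Function.support x).Finite}

/-- `G` is order controllable. -/
def IsOrderControllable {H : Type*} [AddCommGroup H] (G : AddSubgroup (ℤ → H)) : Prop :=
  ∃ n₀ : ℕ, 0 < n₀ ∧ ∀ g ∈ G, ∃ g₁ ∈ G,
    (∀ i : ℤ, i ≤ 0 → g₁ i = g i) ∧ (∀ i : ℤ, (n₀ : ℤ) < i → g₁ i = 0) ∧
    addOrderOf (fun j : Fin n₀ => g₁ ((j : ℤ) + 1)) ∣
      addOrderOf (fun j : Fin n₀ => g ((j : ℤ) + 1))

/-- A noncatastrophic isomorphic encoder for `G` with symbol group `K`: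
a topological group isomorphism `Φ : K^ℤ → G` commuting with the shift and
mapping the finitely supported sequences onto `G_f`. -/
def IsNoncatEncoder {H : Type*} [AddCommGroup H] [TopologicalSpace H]
    (G : AddSubgroup (ℤ → H)) (K : Type*) [AddCommGroup K] [TopologicalSpace K] : Prop :=
  ∃ Φ : (ℤ → K) ≃+ G,
    Continuous Φ ∧ Continuous Φ.symm ∧
    (∀ u : ℤ → K, ((Φ (shift u) : ℤ → H)) = shift ((Φ u : ℤ → H))) ∧
    ((fun u : ℤ → K => ((Φ u : ℤ → H))) '' {u | (Function.support u).Finite} = finSupp G)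

open LaurentPolynomial

namespace LaurentPolynomial

theorem isPrincipalIdealRing (k : Type*) [Field k] : IsPrincipalIdealRing k[T;T⁻¹] where
  principal I := by
    rw [← IsLocalization.map_under (Submonoid.powers (Polynomial.X : Polynomial k)) k[T;T⁻¹] I]
    exact Submodule.IsPrincipal.map_ringHom _ (IsPrincipalIdealRing.principal _)

theorem isNoetherianRing (k : Type*) [CommRing k] [IsNoetherianRing k] :
    IsNoetherianRing k[T;T⁻¹] :=
  IsLocalization.isNoetherianRing (Submonoid.powers (Polynomial.X : Polynomial k)) _ inferInstance

/-- A nonzero Laurent polynomial over a finite field divides `T ^ P - 1` for some `P > 0`. -/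
theorem exists_dvd_T_sub_one {k : Type*} [Field k] [Finite k] {f : k[T;T⁻¹]} (hf : f ≠ 0) :
    ∃ P : ℕ, 0 < P ∧ f ∣ T (P : ℤ) - 1 := by
  obtain ⟨n, g, hg⟩ := exists_T_pow f
  have hg0 : g ≠ 0 := by
    rintro rfl
    rw [map_zero] at hg
    exact hf ((isUnit_T n).mul_left_eq_zero.1 hg.symm)
  have : Module.Finite k (AdjoinRoot g) := (AdjoinRoot.powerBasis hg0).finite
  have : Finite (AdjoinRoot g) := Module.finite_of_finite k
  obtain ⟨a, b, hab, h⟩ := Finite.exists_ne_map_eq_of_infinite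
    (fun n : ℕ => AdjoinRoot.mk g (Polynomial.X ^ n))
  wlog hlt : a < b generalizing a b
  · exact this b a hab.symm h.symm (by omega)
  refine ⟨b - a, by omega, ?_⟩
  obtain ⟨q, hq⟩ := AdjoinRoot.mk_eq_mk.1 h.symm
  have hq' := congrArg Polynomial.toLaurent hq
  simp only [map_sub, map_mul, Polynomial.toLaurent_X_pow, hg] at hq'
  refine ⟨T n * Polynomial.toLaurent q * T (-a), ?_⟩
  have h1 : (T b - T a : k[T;T⁻¹]) * T (-a) = T ((b - a : ℕ) : ℤ) - 1 := by
    rw [sub_mul, ← T_add, ← T_add, ← T_zero]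
    congr 2
    · push_cast [hlt.le]; ring
    · ring
  rw [← h1, hq']
  ring

theorem natCast_dvd_of_map_eq_zero (p : ℕ) {r : ℤ[T;T⁻¹]}
    (hr : AddMonoidAlgebra.mapRingHom ℤ (Int.castRingHom (ZMod p)) r = 0) :
    (p : ℤ[T;T⁻¹]) ∣ r := by
  have h : ∀ n, (p : ℤ) ∣ r.coeff n := fun n => by
    have := congrArg (fun s : (ZMod p)[T;T⁻¹] => s.coeff n) hr
    simpa [ZMod.intCast_zmod_eq_zero_iff_dvd] using this
  refine ⟨.ofCoeff (r.coeff.mapRange (· / (p : ℤ)) (Int.zero_ediv _)), ?_⟩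
  rw [← nsmul_eq_mul]
  ext n
  simp [-nsmul_eq_mul, Int.mul_ediv_cancel' (h n)]

/-- A finitely generated module over `ℤ[T;T⁻¹]` killed by a prime `p` and without
`T ^ P - 1`-torsion is free over `𝔽_p[T;T⁻¹]`. -/
theorem exists_basis_mod_prime {Q : Type*} [AddCommGroup Q] [Module ℤ[T;T⁻¹] Q]
    [Module.Finite ℤ[T;T⁻¹] Q] (p : ℕ) [Fact p.Prime] (hp : ∀ x : Q, p • x = 0)
    (htf : ∀ (P : ℕ) (x : Q), 0 < P → (T (P : ℤ) - 1 : ℤ[T;T⁻¹]) • x = 0 → x = 0) :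
    ∃ (r : ℕ) (b : Fin r → Q), Submodule.span ℤ[T;T⁻¹] (Set.range b) = ⊤ ∧
      ∀ c : Fin r → ℤ[T;T⁻¹], ∑ i, c i • b i = 0 → ∀ i, (p : ℤ[T;T⁻¹]) ∣ c i := by
  let φ : ℤ[T;T⁻¹] →+* (ZMod p)[T;T⁻¹] := AddMonoidAlgebra.mapRingHom ℤ (Int.castRingHom (ZMod p))
  have hφ : Function.Surjective φ :=
    AddMonoidAlgebra.map_surjective (Int.castRingHom (ZMod p)).toAddMonoidHom
      ZMod.intCast_surjective
  have hker : ∀ r, φ r = 0 → ∀ x : Q, r • x = 0 := fun r hr x => by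
    obtain ⟨s, rfl⟩ := natCast_dvd_of_map_eq_zero p hr
    rw [mul_smul, Nat.cast_smul_eq_nsmul, hp]
  let : SMul (ZMod p)[T;T⁻¹] Q := ⟨fun s x => surjInv hφ s • x⟩
  have hsm : ∀ (r : ℤ[T;T⁻¹]) (x : Q), φ r • x = r • x := fun r x => by
    change surjInv hφ (φ r) • x = r • x
    rw [← sub_eq_zero, ← sub_smul]
    exact hker _ (by rw [map_sub, surjInv_eq hφ, sub_self]) x
  let : Module (ZMod p)[T;T⁻¹] Q := Function.Surjective.moduleLeft φ hφ hsm
  have := isPrincipalIdealRing (ZMod p)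
  have hspan : ∀ s : Set Q, Submodule.span ℤ[T;T⁻¹] s = ⊤ ↔
      Submodule.span (ZMod p)[T;T⁻¹] s = ⊤ := fun s => by
    simp only [Submodule.eq_top_iff']
    refine forall_congr' fun x => ⟨fun h => ?_, fun h => ?_⟩
    · induction h using Submodule.span_induction with
      | mem y hy => exact Submodule.subset_span hy
      | zero => exact zero_mem _
      | add y z _ _ hy hz => exact add_mem hy hz
      | smul r y _ hy => exact hsm r y ▸ Submodule.smul_mem _ _ hy
    · induction h using Submodule.span_induction with
      | mem y hy => exact Submodule.subset_span hy
      | zero => exact zero_mem _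
      | add y z _ _ hy hz => exact add_mem hy hz
      | smul r y _ hy => exact Submodule.smul_mem _ _ hy
  have : Module.Finite (ZMod p)[T;T⁻¹] Q := by
    obtain ⟨s, hs⟩ := Module.finite_def.1 ‹Module.Finite ℤ[T;T⁻¹] Q›
    exact ⟨s, (hspan _).1 hs⟩
  have : IsDomain (ZMod p)[T;T⁻¹] := inferInstance
  have : Module.IsTorsionFree (ZMod p)[T;T⁻¹] Q := by
    rw [Module.isTorsionFree_iff_smul_eq_zero]
    refine fun f x hfx => or_iff_not_imp_left.2 fun hf => ?_
    obtain ⟨P, hP, g, hg⟩ := exists_dvd_T_sub_one hf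
    refine htf P x hP ?_
    have hT : φ (T (P : ℤ) - 1) = T (P : ℤ) - 1 := by
      rw [map_sub, map_one]
      simp [φ, T, -single_eq_C_mul_T]
    rw [← hsm, hT, hg, mul_comm, mul_smul, hfx, smul_zero]
  have := Module.free_of_finite_type_torsion_free' (R := (ZMod p)[T;T⁻¹]) (M := Q)
  let b := Module.finBasis (ZMod p)[T;T⁻¹] Q
  refine ⟨_, b, (hspan _).2 b.span_eq, fun c hc i => ?_⟩
  refine natCast_dvd_of_map_eq_zero p ?_
  refine Fintype.linearIndependent_iff.1 b.linearIndependent (fun i => φ (c i)) ?_ i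
  simpa only [hsm] using hc


/-- `M` is a direct sum of copies of `(ℤ/m i)[T;T⁻¹]`, generated by the family `e`. -/
structure IsCyclicBasis {M : Type*} [AddCommGroup M] [Module ℤ[T;T⁻¹] M] {ι : Type}
    [Fintype ι] (e : ι → M) (m : ι → ℕ) : Prop where
  pos : ∀ i, 0 < m i
  smul_eq_zero : ∀ i, m i • e i = 0
  exists_eq_sum : ∀ x, ∃ c : ι → ℤ[T;T⁻¹], x = ∑ i, c i • e i
  dvd_of_sum_eq_zero : ∀ c : ι → ℤ[T;T⁻¹], ∑ i, c i • e i = 0 → ∀ i, (m i : ℤ[T;T⁻¹]) ∣ c i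

/-- None of the quotients `M / m M` has `T ^ P - 1`-torsion. -/
def QuotientsTorsionFree (M : Type*) [AddCommGroup M] [Module ℤ[T;T⁻¹] M] : Prop :=
  ∀ (m P : ℕ) (x y : M), 0 < P → (T (P : ℤ) - 1 : ℤ[T;T⁻¹]) • x = m • y → ∃ z, x = m • z

section

variable {M : Type*} [AddCommGroup M] [Module ℤ[T;T⁻¹] M]

/-- The submodule of multiples of `a`. -/
noncomputable abbrev multiples (M : Type*) [AddCommGroup M] [Module ℤ[T;T⁻¹] M] (a : ℕ) :
    Submodule ℤ[T;T⁻¹] M :=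
  (LinearMap.lsmul ℤ[T;T⁻¹] M (a : ℤ[T;T⁻¹])).range

theorem mem_multiples {a : ℕ} {x : M} : x ∈ multiples M a ↔ ∃ y, a • y = x := by
  simp [multiples, Nat.cast_smul_eq_nsmul]

theorem QuotientsTorsionFree.multiples (h : QuotientsTorsionFree M) (a : ℕ) :
    QuotientsTorsionFree (multiples M a) := by
  rintro m P ⟨x, hx⟩ ⟨y, hy⟩ hP hxy
  obtain ⟨y, rfl⟩ := mem_multiples.1 hy
  obtain ⟨z, hz⟩ := h (m * a) P x y hP (by simpa [mul_smul] using congrArg Subtype.val hxy)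
  exact ⟨⟨a • z, mem_multiples.2 ⟨z, rfl⟩⟩, Subtype.ext (by simpa [mul_smul] using hz)⟩

theorem exists_isCyclicBasis_prime_pow (p : ℕ) [hp : Fact p.Prime] (k : ℕ)
    [Module.Finite ℤ[T;T⁻¹] M]
    (h : QuotientsTorsionFree M) (hk : ∀ x : M, p ^ k • x = 0) :
    ∃ (ι : Type) (_ : Fintype ι) (e : ι → M) (m : ι → ℕ), IsCyclicBasis e m ∧ ∀ i, p ∣ m i := by
  induction k generalizing M with
  | zero =>
    have hk' : ∀ x : M, x = 0 := fun x => by simpa using hk x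
    exact ⟨Empty, inferInstance, Empty.elim, Empty.elim,
      ⟨fun i => i.elim, fun i => i.elim, fun x => ⟨0, by simpa using hk' x⟩,
        fun _ _ i => i.elim⟩, fun i => i.elim⟩
  | succ k ih =>
    obtain ⟨ι, _, e, m, he, hm⟩ := ih (M := multiples M p) (h.multiples p) (by
      rintro ⟨x, hx⟩
      obtain ⟨y, rfl⟩ := mem_multiples.1 hx
      exact Subtype.ext (by simpa [← mul_smul, ← pow_succ] using hk y))
    choose f hf using fun i => mem_multiples.1 (e i).2
    have := LaurentPolynomial.isNoetherianRing ℤ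
    have : IsNoetherian ℤ[T;T⁻¹] M := isNoetherian_of_isNoetherianRing_of_finite _ _
    let V := (LinearMap.lsmul ℤ[T;T⁻¹] M (p : ℤ[T;T⁻¹])).ker
    have hV : ∀ x, x ∈ V ↔ p • x = 0 := fun x => by simp [V, Nat.cast_smul_eq_nsmul]
    obtain ⟨r, b, hb, hind⟩ := exists_basis_mod_prime (Q := V.map (multiples M p).mkQ) p
      (by
        rintro ⟨_, x, hx, rfl⟩
        refine Subtype.ext ?_
        change p • (multiples M p).mkQ x = 0
        rw [← map_nsmul, (hV x).1 hx, map_zero])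
      (by
        rintro P ⟨_, x, hx, rfl⟩ hP h0
        have h1 : (multiples M p).mkQ ((T (P : ℤ) - 1 : ℤ[T;T⁻¹]) • x) = 0 := by
          rw [map_smul]
          exact congrArg Subtype.val h0
        rw [Submodule.mkQ_apply, Submodule.Quotient.mk_eq_zero, mem_multiples] at h1
        obtain ⟨y, hy⟩ := h1
        obtain ⟨z, hz⟩ := h p P x y hP hy.symm
        refine Subtype.ext ?_
        change (multiples M p).mkQ x = 0
        rw [Submodule.mkQ_apply, Submodule.Quotient.mk_eq_zero, mem_multiples]
        exact ⟨z, hz.symm⟩)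
    choose v hvV hv using fun i => (b i).2
    have hmk : ∀ d : Fin r → ℤ[T;T⁻¹], (multiples M p).mkQ (∑ i, d i • v i) =
        ((∑ i, d i • b i : V.map (multiples M p).mkQ) : M ⧸ multiples M p) := fun d => by
      rw [map_sum, AddSubmonoidClass.coe_finsetSum]
      exact Finset.sum_congr rfl fun i _ => by rw [map_smul, hv, Submodule.coe_smul]
    have hfe : ∀ c : ι → ℤ[T;T⁻¹], p • ∑ i, c i • f i = ∑ i, c i • (e i : M) := fun c => by
      rw [Finset.smul_sum]
      exact Finset.sum_congr rfl fun i _ => by rw [smul_comm, hf]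
    refine ⟨ι ⊕ Fin r, inferInstance, Sum.elim f v, Sum.elim (fun i => p * m i) fun _ => p,
      ⟨?_, ?_, ?_, ?_⟩, ?_⟩
    · rintro (i | i)
      · exact Nat.mul_pos hp.out.pos (he.pos i)
      · exact hp.out.pos
    · rintro (i | i)
      · have := congrArg Subtype.val (he.smul_eq_zero i)
        simpa [mul_comm p, mul_smul, hf] using this
      · exact (hV _).1 (hvV i)
    · intro x
      obtain ⟨c, hc⟩ := he.exists_eq_sum ⟨p • x, mem_multiples.2 ⟨x, rfl⟩⟩
      have hc' : p • x = ∑ i, c i • (e i : M) := by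
        simpa using congrArg Subtype.val hc
      have hy : x - ∑ i, c i • f i ∈ V := by rw [hV, smul_sub, hfe, hc', sub_self]
      have hy' : (⟨_, _, hy, rfl⟩ : V.map (multiples M p).mkQ) ∈
          Submodule.span ℤ[T;T⁻¹] (Set.range b) := hb ▸ Submodule.mem_top
      obtain ⟨d, hd⟩ := (Submodule.mem_span_range_iff_exists_fun _).1 hy'
      have hw := (hmk d).trans (congrArg Subtype.val hd)
      change _ = (multiples M p).mkQ _ at hw
      rw [← sub_eq_zero, ← map_sub, ← neg_eq_zero, ← map_neg, neg_sub, Submodule.mkQ_apply,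
        Submodule.Quotient.mk_eq_zero] at hw
      obtain ⟨c', hc''⟩ := he.exists_eq_sum ⟨_, hw⟩
      have hw' : x - ∑ i, c i • f i - ∑ i, d i • v i = ∑ i, c' i • (e i : M) := by
        simpa using congrArg Subtype.val hc''
      refine ⟨Sum.elim (fun i => c i + p * c' i) d, ?_⟩
      simp only [Fintype.sum_sum_type, Sum.elim_inl, Sum.elim_inr, add_smul,
        Finset.sum_add_distrib, mul_smul, Nat.cast_smul_eq_nsmul, ← Finset.smul_sum, hfe, ← hw']
      abel
    · intro c hc
      simp only [Fintype.sum_sum_type, Sum.elim_inl, Sum.elim_inr] at hc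
      have h1 : ∑ i, c (.inl i) • (e i : M) = 0 := by
        have h2 : p • ∑ i, c (.inr i) • v i = 0 := by
          rw [← hV]
          exact Submodule.sum_mem _ fun i _ => Submodule.smul_mem _ _ (hvV i)
        have := congrArg (p • ·) hc
        simpa only [smul_add, hfe, h2, add_zero, smul_zero] using this
      have h2 := he.dvd_of_sum_eq_zero (fun i => c (.inl i)) (Subtype.ext (by simpa using h1))
      choose c' hc' using fun i => (Nat.cast_dvd_cast (hm i)).trans (h2 i)
      have h3 : ∑ i, c (.inl i) • f i = ∑ i, c' i • (e i : M) := by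
        refine Finset.sum_congr rfl fun i _ => ?_
        rw [hc', mul_comm, mul_smul, Nat.cast_smul_eq_nsmul, hf]
      have h4 : ∀ i, (p : ℤ[T;T⁻¹]) ∣ c (.inr i) := by
        refine hind (fun i => c (.inr i)) (Subtype.ext ?_)
        rw [← hmk, eq_neg_of_add_eq_zero_right hc, h3, map_neg, neg_eq_zero.2, ZeroMemClass.coe_zero]
        rw [Submodule.mkQ_apply, Submodule.Quotient.mk_eq_zero]
        exact Submodule.sum_mem _ fun i _ => Submodule.smul_mem _ _ (e i).2
      have h5 : ∑ i, c (.inr i) • v i = 0 := by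
        refine Finset.sum_eq_zero fun i _ => ?_
        obtain ⟨d, hd⟩ := h4 i
        rw [hd, mul_comm, mul_smul, Nat.cast_smul_eq_nsmul, (hV _).1 (hvV i), smul_zero]
      rw [h5, add_zero, h3] at hc
      have h6 := he.dvd_of_sum_eq_zero c' (Subtype.ext (by simpa using hc))
      rintro (i | i)
      · simpa [hc'] using mul_dvd_mul_left (p : ℤ[T;T⁻¹]) (h6 i)
      · exact h4 i
    · rintro (i | i)
      · exact dvd_mul_right _ _
      · exact dvd_rfl

theorem exists_isCyclicBasis (N : ℕ) (hN : 0 < N) [Module.Finite ℤ[T;T⁻¹] M]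
    (h : QuotientsTorsionFree M) (hk : ∀ x : M, N • x = 0) :
    ∃ (ι : Type) (_ : Fintype ι) (e : ι → M) (m : ι → ℕ), IsCyclicBasis e m := by
  induction N using Nat.recOnPosPrimePosCoprime generalizing M with
  | zero => exact absurd hN (lt_irrefl 0)
  | one =>
    have hk' : ∀ x : M, x = 0 := fun x => by simpa using hk x
    exact ⟨Empty, inferInstance, Empty.elim, Empty.elim,
      ⟨fun i => i.elim, fun i => i.elim, fun x => ⟨0, by simpa using hk' x⟩,
        fun _ _ i => i.elim⟩⟩
  | prime_pow p n hp _ =>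
    have : Fact p.Prime := ⟨hp⟩
    obtain ⟨ι, i, e, m, he, _⟩ := exists_isCyclicBasis_prime_pow p n h hk
    exact ⟨ι, i, e, m, he⟩
  | coprime a b ha hb hab iha ihb =>
    obtain ⟨ι, _, e, m, he⟩ := ihb (by omega) (M := multiples M a) (h.multiples a) (by
      rintro ⟨x, hx⟩
      obtain ⟨y, rfl⟩ := mem_multiples.1 hx
      exact Subtype.ext (by simpa [← mul_smul, mul_comm b] using hk y))
    obtain ⟨κ, _, f, n, hf⟩ := iha (by omega) (M := multiples M b) (h.multiples b) (by
      rintro ⟨x, hx⟩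
      obtain ⟨y, rfl⟩ := mem_multiples.1 hx
      exact Subtype.ext (by simpa [← mul_smul] using hk y))
    have hcop : IsCoprime (a : ℤ) b := Nat.isCoprime_iff_coprime.2 hab
    refine ⟨ι ⊕ κ, inferInstance, Sum.elim (fun i => e i) (fun i => f i), Sum.elim m n,
      ⟨?_, ?_, ?_, ?_⟩⟩
    · rintro (i | i)
      · exact he.pos i
      · exact hf.pos i
    · rintro (i | i)
      · simpa using congrArg Subtype.val (he.smul_eq_zero i)
      · simpa using congrArg Subtype.val (hf.smul_eq_zero i)
    · intro x
      obtain ⟨u, v, huv⟩ := hcop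
      obtain ⟨c, hc⟩ := he.exists_eq_sum ⟨a • u • x, mem_multiples.2 ⟨_, rfl⟩⟩
      obtain ⟨d, hd⟩ := hf.exists_eq_sum ⟨b • v • x, mem_multiples.2 ⟨_, rfl⟩⟩
      refine ⟨Sum.elim c d, ?_⟩
      have hc' := congrArg Subtype.val hc
      have hd' := congrArg Subtype.val hd
      simp only [AddSubmonoidClass.coe_finsetSum, Submodule.coe_smul] at hc' hd'
      simp only [Fintype.sum_sum_type, Sum.elim_inl, Sum.elim_inr, ← hc', ← hd']
      rw [← natCast_zsmul, ← natCast_zsmul, ← mul_smul, ← mul_smul, ← add_smul, mul_comm _ u,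
        mul_comm _ v, huv, one_smul]
    · intro c hc
      simp only [Fintype.sum_sum_type, Sum.elim_inl, Sum.elim_inr] at hc
      have key : ∀ x ∈ multiples M a, ∀ y ∈ multiples M b, x + y = 0 → x = 0 ∧ y = 0 := by
        intro x hx y hy hxy
        obtain ⟨u, v, huv⟩ := hcop
        obtain ⟨x, rfl⟩ := mem_multiples.1 hx
        obtain ⟨y, rfl⟩ := mem_multiples.1 hy
        have h1 : b • a • x = 0 := by rw [← mul_smul, mul_comm, hk]
        have h2 : a • a • x = 0 := by
          rw [eq_neg_of_add_eq_zero_left hxy, smul_neg, ← mul_smul, hk, neg_zero]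
        have h3 : a • x = 0 := by
          rw [← one_smul ℤ (a • x), ← huv, add_smul, mul_smul, mul_smul, natCast_zsmul,
            natCast_zsmul, h1, h2, smul_zero, smul_zero, add_zero]
        exact ⟨h3, by rwa [h3, zero_add] at hxy⟩
      obtain ⟨h1, h2⟩ := key _ (Submodule.sum_mem _ fun i _ => Submodule.smul_mem _ _ (e i).2) _
        (Submodule.sum_mem _ fun i _ => Submodule.smul_mem _ _ (f i).2) hc
      have h1' := he.dvd_of_sum_eq_zero (fun i => c (.inl i)) (Subtype.ext (by simpa using h1))
      have h2' := hf.dvd_of_sum_eq_zero (fun i => c (.inr i)) (Subtype.ext (by simpa using h2))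
      rintro (i | i)
      · exact h1' i
      · exact h2' i

end

section FinitelySupported

variable {H : Type*} [AddCommGroup H]

/-- The action of `ℤ[T;T⁻¹]` on finitely supported sequences in which `T` is the right shift. -/
noncomputable abbrev finsuppLaurentModule (H : Type*) [AddCommGroup H] :
    Module ℤ[T;T⁻¹] (ℤ →₀ H) :=
  Module.compHom _ (AddMonoidAlgebra.lift ℤ (Module.End ℤ (ℤ →₀ H)) ℤ
    { toFun := fun n => Finsupp.lmapDomain H ℤ (· + n.toAdd)
      map_one' := by ext; simp
      map_mul' := fun a b => by
        ext
        simp [add_left_comm, add_comm] }).toRingHom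

attribute [local instance] finsuppLaurentModule

theorem T_smul_eq_mapDomain (n : ℤ) (x : ℤ →₀ H) :
    (T n : ℤ[T;T⁻¹]) • x = x.mapDomain (· + n) := by
  change (AddMonoidAlgebra.lift ℤ (Module.End ℤ (ℤ →₀ H)) ℤ _ (.single n 1)) x = _
  rw [AddMonoidAlgebra.lift_single]
  simp

theorem T_smul_apply (n : ℤ) (x : ℤ →₀ H) (i : ℤ) :
    ((T n : ℤ[T;T⁻¹]) • x) i = x (i - n) := by
  rw [T_smul_eq_mapDomain]
  conv_lhs => rw [← sub_add_cancel i n]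
  exact Finsupp.mapDomain_apply (add_left_injective n) x (i - n)

theorem C_smul_eq_zsmul (a : ℤ) (x : ℤ →₀ H) : (C a : ℤ[T;T⁻¹]) • x = a • x := by
  rw [eq_intCast, Int.cast_smul_eq_zsmul]

instance [Finite H] : Module.Finite ℤ[T;T⁻¹] (ℤ →₀ H) := by
  refine ⟨Submodule.fg_def.2 ⟨_, Set.finite_range (Finsupp.single (0 : ℤ) : H → ℤ →₀ H), ?_⟩⟩
  refine Submodule.eq_top_iff'.2 fun x => ?_
  induction x using Finsupp.induction_linear with
  | zero => exact zero_mem _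
  | add x y hx hy => exact add_mem hx hy
  | single n h =>
    have : Finsupp.single n h = (T n : ℤ[T;T⁻¹]) • Finsupp.single 0 h := by
      rw [T_smul_eq_mapDomain, Finsupp.mapDomain_single, zero_add]
    rw [this]
    exact Submodule.smul_mem _ _ (Submodule.subset_span ⟨h, rfl⟩)

/-- The sum `∑ n, T n • w n`. -/
noncomputable def shiftSum (K : Submodule ℤ (ℤ →₀ H)) : (ℤ →₀ K) →+ (ℤ →₀ H) :=
  Finsupp.liftAddHom fun n =>
    (DistribSMul.toAddMonoidHom (ℤ →₀ H) (T n : ℤ[T;T⁻¹])).comp K.subtype.toAddMonoidHom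

theorem shiftSum_single (K : Submodule ℤ (ℤ →₀ H)) (n : ℤ) (k : K) :
    shiftSum K (Finsupp.single n k) = (T n : ℤ[T;T⁻¹]) • (k : ℤ →₀ H) := by
  simp [shiftSum]

theorem shiftSum_apply (K : Submodule ℤ (ℤ →₀ H)) (w : ℤ →₀ K) :
    shiftSum K w = ∑ n ∈ w.support, (T n : ℤ[T;T⁻¹]) • (w n : ℤ →₀ H) := by
  simp [shiftSum, Finsupp.liftAddHom_apply, Finsupp.sum]

theorem exists_finite_shiftSum_bijective [Finite H] (M : Submodule ℤ[T;T⁻¹] (ℤ →₀ H))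
    (h : QuotientsTorsionFree M) :
    ∃ K : Submodule ℤ (ℤ →₀ H), Finite K ∧ (∀ k ∈ K, k ∈ M) ∧
      (∀ x ∈ M, ∃ w, shiftSum K w = x) ∧ ∀ w, shiftSum K w = 0 → w = 0 := by
  have hN : ∀ x : ℤ →₀ H, Nat.card H • x = 0 := fun x => by
    ext i
    simp
  have := LaurentPolynomial.isNoetherianRing ℤ
  have : IsNoetherian ℤ[T;T⁻¹] (ℤ →₀ H) := isNoetherian_of_isNoetherianRing_of_finite _ _
  obtain ⟨ι, _, e, m, he⟩ := exists_isCyclicBasis (Nat.card H) Nat.card_pos h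
    fun x => Subtype.ext (by simpa using hN x)
  let K : Submodule ℤ (ℤ →₀ H) := Submodule.span ℤ (Set.range fun i => (e i : ℤ →₀ H))
  have heK : ∀ i, (e i : ℤ →₀ H) ∈ K := fun i => Submodule.subset_span ⟨i, rfl⟩
  refine ⟨K, ?_, fun k hk => ?_, fun x hx => ?_, fun w hw => ?_⟩
  · have : Module.Finite ℤ K := Module.Finite.span_of_finite ℤ (Set.finite_range _)
    refine Module.finite_of_fg_torsion K fun x =>
      ⟨⟨(Nat.card H : ℤ), mem_nonZeroDivisors_of_ne_zero (by exact_mod_cast Nat.card_pos.ne')⟩, ?_⟩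
    exact Subtype.ext (by simpa using hN x)
  · induction hk using Submodule.span_induction with
    | mem x hx =>
      obtain ⟨i, rfl⟩ := hx
      exact (e i).2
    | zero => exact zero_mem _
    | add x y _ _ hx hy => exact add_mem hx hy
    | smul a x _ hx => exact C_smul_eq_zsmul a x ▸ M.smul_mem _ hx
  · obtain ⟨c, hc⟩ := he.exists_eq_sum ⟨x, hx⟩
    have hc' : x = ∑ i, c i • (e i : ℤ →₀ H) := by simpa using congrArg Subtype.val hc
    change x ∈ (shiftSum K).range
    rw [hc']
    refine AddSubgroup.sum_mem _ fun i _ => ?_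
    induction c i using LaurentPolynomial.induction_on' with
    | add p q hp hq => exact add_smul p q (e i : ℤ →₀ H) ▸ add_mem hp hq
    | C_mul_T n a =>
      refine ⟨Finsupp.single n (a • ⟨e i, heK i⟩), ?_⟩
      rw [shiftSum_single, mul_comm, mul_smul, C_smul_eq_zsmul]
      rfl
  · choose a ha using fun n => (Submodule.mem_span_range_iff_exists_fun ℤ).1 (w n).2
    let c : ι → ℤ[T;T⁻¹] := fun i => ∑ n ∈ w.support, C (a n i) * T n
    have hc : ∑ i, c i • e i = 0 := by
      refine Subtype.ext ?_
      simp only [AddSubmonoidClass.coe_finsetSum, Submodule.coe_smul, ZeroMemClass.coe_zero]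
      rw [← hw, shiftSum_apply]
      simp only [c, Finset.sum_smul]
      rw [Finset.sum_comm]
      refine Finset.sum_congr rfl fun n _ => ?_
      rw [← ha, Finset.smul_sum]
      exact Finset.sum_congr rfl fun i _ => by rw [mul_comm, mul_smul, C_smul_eq_zsmul]
    have hdvd := he.dvd_of_sum_eq_zero c hc
    ext1 n
    by_contra hn
    refine hn (Subtype.ext ?_)
    rw [← ha]
    refine Finset.sum_eq_zero fun i _ => ?_
    obtain ⟨d, hd⟩ := hdvd i
    have hcoeff : a n i = m i * d.coeff n := by
      have h1 : (c i).coeff n = a n i := by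
        have hn' : n ∈ w.support := Finsupp.mem_support_iff.2 hn
        simp only [c, ← single_eq_C_mul_T, AddMonoidAlgebra.coeff_sum, Finsupp.finsetSum_apply,
          AddMonoidAlgebra.coeff_single, Finsupp.single_apply]
        rw [Finset.sum_ite_eq' w.support n, if_pos hn']
      rw [← h1, hd, ← nsmul_eq_mul, AddMonoidAlgebra.coeff_smul, Finsupp.smul_apply, nsmul_eq_mul]
    have hm : m i • (e i : ℤ →₀ H) = 0 := by
      simpa using congrArg Subtype.val (he.smul_eq_zero i)
    rw [hcoeff, mul_comm, mul_smul, natCast_zsmul, hm, smul_zero]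

end FinitelySupported

end LaurentPolynomial

section Dynamics

theorem shiftPow_shiftPow {H : Type*} (m n : ℤ) (x : ℤ → H) :
    shiftPow m (shiftPow n x) = shiftPow (m + n) x := by
  funext i
  simp [shiftPow, add_assoc]

theorem shiftPow_zero {H : Type*} (x : ℤ → H) : shiftPow 0 x = x := by
  funext i
  simp [shiftPow]

theorem mem_closed_of_agree {X : Type*} [TopologicalSpace X] {C : Set (ℤ → X)} (hC : IsClosed C)
    {x : ℤ → X} (h : ∀ n : ℕ, ∃ c ∈ C, ∀ i ∈ Set.Icc (-n : ℤ) n, c i = x i) : x ∈ C := by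
  choose c hcC hc using h
  refine hC.mem_of_tendsto (f := c) (b := Filter.atTop) ?_ (Filter.Eventually.of_forall hcC)
  refine tendsto_pi_nhds.2 fun i => tendsto_const_nhds.congr' ?_
  filter_upwards [Filter.eventually_ge_atTop i.natAbs] with n hn
  exact (hc n i ⟨by omega, by omega⟩).symm

variable {H : Type*} [AddCommGroup H]

theorem finite_support_of_forall_Icc {x : ℤ → H} {a b : ℤ} (h : ∀ i ∉ Set.Icc a b, x i = 0) :
    (support x).Finite :=
  (Set.finite_Icc a b).subset fun i hi => by
    by_contra hn
    exact hi (h i hn)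

theorem exists_window {x : ℤ → H} (hx : (support x).Finite) :
    ∃ a : ℕ, ∀ i ∉ Set.Icc (-a : ℤ) a, x i = 0 := by
  obtain ⟨a, ha⟩ := (hx.image Int.natAbs).bddAbove
  refine ⟨a, fun i hi => ?_⟩
  by_contra hxi
  exact hi (by have := ha ⟨i, hxi, rfl⟩; constructor <;> omega)

attribute [local instance] LaurentPolynomial.finsuppLaurentModule

theorem T_smul_eq_shiftPow (n : ℤ) (x : ℤ →₀ H) :
    ⇑((T n : ℤ[T;T⁻¹]) • x) = shiftPow (-n) x := by
  funext i
  simp [T_smul_apply, shiftPow, sub_eq_add_neg]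

/-- The sliding block map `K^ℤ → H^ℤ` sending the sequence `k` at `0` to `k` itself, when all
elements of `K` are supported in `[-L, L]`. -/
noncomputable def encode (K : Submodule ℤ (ℤ →₀ H)) (L : ℕ) : (ℤ → K) →+ (ℤ → H) where
  toFun u i := ∑ l ∈ Finset.Icc (-L : ℤ) L, (u (i - l) : ℤ →₀ H) l
  map_zero' := by
    funext i
    simp
  map_add' u v := by
    funext i
    simp [Finset.sum_add_distrib]

section Encode

variable {K : Submodule ℤ (ℤ →₀ H)} {L : ℕ}

theorem encode_apply (u : ℤ → K) (i : ℤ) :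
    encode K L u i = ∑ l ∈ Finset.Icc (-L : ℤ) L, (u (i - l) : ℤ →₀ H) l := rfl

theorem encode_shiftPow (n : ℤ) (u : ℤ → K) :
    encode K L (shiftPow n u) = shiftPow n (encode K L u) := by
  funext i
  simp only [encode_apply, shiftPow]
  exact Finset.sum_congr rfl fun l _ => by rw [sub_add_eq_add_sub]

theorem encode_finsupp (hL : ∀ k ∈ K, ∀ i ∉ Set.Icc (-L : ℤ) L, k i = 0) (w : ℤ →₀ K) :
    encode K L w = shiftSum K w := by
  induction w using Finsupp.induction_linear with
  | zero => simp
  | add v w hv hw => rw [Finsupp.coe_add, map_add, map_add, hv, hw, Finsupp.coe_add]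
  | single n k =>
    funext i
    rw [shiftSum_single, T_smul_apply, encode_apply]
    rw [Finset.sum_eq_single (i - n)]
    · simp
    · intro l _ hl
      rw [Finsupp.single_eq_of_ne (by omega)]
      simp
    · intro hi
      rw [sub_sub_cancel, Finsupp.single_eq_same]
      exact hL k k.2 _ (by simpa using hi)

/-- A map `encode K L` that is bijective between the finitely supported sequences and the finitely
supported elements of a subgroup containing its range is injective. -/
theorem encode_injective [Finite H] {G : AddSubgroup (ℤ → H)} (hmem : ∀ u, encode K L u ∈ G)
    (hsurj : ∀ x ∈ G, (support x).Finite →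
      ∃ u : ℤ → K, (support u).Finite ∧ encode K L u = x)
    (hinj : ∀ u : ℤ → K, (support u).Finite → encode K L u = 0 → u = 0) :
    Injective (encode K L) := by
  obtain ⟨B, hB⟩ : ∃ B : ℕ, ∀ x ∈ G, (∀ i ∉ Set.Icc (-L : ℤ) L, x i = 0) →
      ∃ v : ℤ → K, encode K L v = x ∧ ∀ i ∉ Set.Icc (-B : ℤ) B, v i = 0 := by
    let F : Set (ℤ → H) := {x | x ∈ G ∧ ∀ i ∉ Set.Icc (-L : ℤ) L, x i = 0}
    have : Finite F := by
      refine Finite.of_injective (fun (x : F) (i : Set.Icc (-L : ℤ) L) => x.1 i) fun x y hxy => ?_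
      refine Subtype.ext (funext fun i => ?_)
      by_cases hi : i ∈ Set.Icc (-L : ℤ) L
      · exact congrFun hxy ⟨i, hi⟩
      · rw [x.2.2 i hi, y.2.2 i hi]
    choose v hvf hv using fun x : F => hsurj x x.2.1 (finite_support_of_forall_Icc x.2.2)
    choose b hb using fun x : F => exists_window (hvf x)
    obtain ⟨B, hB⟩ := Finite.exists_le b
    refine ⟨B, fun x hx hxL => ⟨v ⟨x, hx, hxL⟩, hv _, fun i hi => hb _ i fun hi' => hi ?_⟩⟩
    have := hB ⟨x, hx, hxL⟩
    rw [Set.mem_Icc] at hi' ⊢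
    omega
  rw [injective_iff_map_eq_zero]
  intro u hu
  let cut : ℤ → ℤ → K := fun n i => if n ≤ i then u i else 0
  have hcut : ∀ n, ∀ i ∉ Set.Icc (-L : ℤ) L, shiftPow n (encode K L (cut n)) i = 0 := by
    intro n i hi
    rw [Set.mem_Icc, not_and_or, not_le, not_le] at hi
    rw [shiftPow, encode_apply]
    rcases hi with hi | hi
    · refine Finset.sum_eq_zero fun l hl => ?_
      rw [Finset.mem_Icc] at hl
      simp only [cut]
      rw [if_neg (by omega)]
      simp
    · refine (Finset.sum_congr rfl fun l hl => ?_).trans (congrFun hu (i + n))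
      rw [Finset.mem_Icc] at hl
      simp only [cut]
      rw [if_pos (by omega)]
  have htail : ∀ n : ℤ, ∃ d : ℤ → K, encode K L d = 0 ∧ (∀ i > n + B, d i = u i) ∧
      ∀ i < n - B, d i = 0 := by
    intro n
    obtain ⟨v, hv, hvB⟩ := hB (encode K L (shiftPow n (cut n))) (hmem _)
      (by rw [encode_shiftPow]; exact hcut n)
    refine ⟨cut n - shiftPow (-n) v, ?_, fun i hi => ?_, fun i hi => ?_⟩
    · rw [map_sub, encode_shiftPow, hv, encode_shiftPow, shiftPow_shiftPow, neg_add_cancel,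
        shiftPow_zero, sub_self]
    · simp only [Pi.sub_apply, cut, shiftPow]
      rw [if_pos (by omega), hvB _ (by rw [Set.mem_Icc]; omega), sub_zero]
    · simp only [Pi.sub_apply, cut, shiftPow]
      rw [if_neg (by omega), hvB _ (by rw [Set.mem_Icc]; omega), sub_zero]
  funext i
  obtain ⟨d, hd, hdr, hdl⟩ := htail (i - B - 1)
  obtain ⟨d', hd', hdr', hdl'⟩ := htail (i + B + 1)
  have heq : d - d' = 0 := by
    refine hinj _ (finite_support_of_forall_Icc (a := i - B - 1 - B) (b := i + B + 1 + B)
      fun j hj => ?_) (by rw [map_sub, hd, hd', sub_zero])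
    rw [Set.mem_Icc, not_and_or, not_le, not_le] at hj
    rcases hj with hj | hj
    · rw [Pi.sub_apply, hdl j hj, hdl' j (by omega), sub_zero]
    · rw [Pi.sub_apply, hdr j (by omega), hdr' j hj, sub_self]
  rw [← hdr i (by omega), sub_eq_zero.1 heq, hdl' i (by omega), Pi.zero_apply]

theorem continuous_encode [TopologicalSpace H] [TopologicalSpace K]
    [DiscreteTopology K] [ContinuousAdd H] : Continuous (encode K L) := by
  refine continuous_pi fun i => ?_
  simp only [encode_apply]
  refine continuous_finsetSum _ fun l _ => ?_
  exact (continuous_of_discreteTopology (f := fun k : K => (k : ℤ →₀ H) l)).comp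
    (continuous_apply (i - l))

end Encode

variable [TopologicalSpace H] {G : AddSubgroup (ℤ → H)}

theorem IsGroupShift.shiftPow_mem (hG : IsGroupShift G) (n : ℤ) {x : ℤ → H} (hx : x ∈ G) :
    shiftPow n x ∈ G := by
  have h1 : ∀ y ∈ G, shiftPow 1 y ∈ G := fun y hy => hG.2.subset ⟨y, hy, rfl⟩
  have h2 : ∀ y ∈ G, shiftPow (-1) y ∈ G := fun y hy => by
    obtain ⟨z, hz, rfl⟩ := hG.2.superset hy
    simpa [shiftPow_shiftPow, shiftPow_zero] using hz
  induction n using Int.induction_on with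
  | zero => rwa [shiftPow_zero]
  | succ n ih => simpa [shiftPow_shiftPow, add_comm] using h1 _ ih
  | pred n ih => simpa [shiftPow_shiftPow, add_comm, sub_eq_add_neg] using h2 _ ih

/-- Order controllability lets one cut off the future of an element of `G`, without enlarging the
order of the transition block. -/
theorem IsOrderControllable.exists_cut (hG : IsGroupShift G) (hoc : IsOrderControllable G) :
    ∃ n₀ : ℕ, ∀ g ∈ G, ∀ a : ℤ, ∃ g₁ ∈ G, (∀ i ≤ a, g₁ i = g i) ∧ (∀ i, a + n₀ < i → g₁ i = 0) ∧
      ∀ m : ℕ, (∀ i, a < i → i ≤ a + n₀ → m • g i = 0) → ∀ i, a < i → m • g₁ i = 0 := by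
  obtain ⟨n₀, -, h⟩ := hoc
  refine ⟨n₀, fun g hg a => ?_⟩
  obtain ⟨g₁, hg₁, hl, hr, ho⟩ := h _ (hG.shiftPow_mem a hg)
  refine ⟨_, hG.shiftPow_mem (-a) hg₁, fun i hi => ?_, fun i hi => hr _ (by omega),
    fun m hm i hi => ?_⟩
  · exact (hl _ (by omega)).trans (by simp [shiftPow])
  · by_cases hi' : (n₀ : ℤ) < i + -a
    · exact (congrArg (m • ·) (hr _ hi')).trans (smul_zero m)
    · have h1 := ho.trans (addOrderOf_dvd_iff_nsmul_eq_zero.2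
        (show m • (fun j : Fin n₀ => shiftPow a g ((j : ℤ) + 1)) = 0 from
          funext fun j => hm _ (by omega) (by omega)))
      have h2 := congrFun (addOrderOf_dvd_iff_nsmul_eq_zero.1 h1)
        ⟨(i + -a - 1).toNat, by omega⟩
      have h3 : (((i + -a - 1).toNat : ℕ) : ℤ) + 1 = i + -a := by omega
      rw [Pi.smul_apply, h3] at h2
      exact h2

/-- An element of `G` agrees on a given window with a finitely supported one, and multiples of it
that vanish outside the window still do so. -/
theorem IsOrderControllable.exists_finite_support (hG : IsGroupShift G)
    (hoc : IsOrderControllable G) {g : ℤ → H} (hg : g ∈ G) (a : ℕ) :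
    ∃ g₁ ∈ G, (support g₁).Finite ∧ (∀ i ∈ Set.Icc (-a : ℤ) a, g₁ i = g i) ∧
      ∀ m : ℕ, (∀ i ∉ Set.Icc (-a : ℤ) a, m • g i = 0) →
        ∀ i ∉ Set.Icc (-a : ℤ) a, m • g₁ i = 0 := by
  obtain ⟨n₀, hcut⟩ := hoc.exists_cut hG
  obtain ⟨g₁, hg₁, hl, hr, ho⟩ := hcut g hg a
  obtain ⟨g₂, hg₂, hl', hr', ho'⟩ := hcut g₁ hg₁ (-a - 1 - n₀)
  refine ⟨g₁ - g₂, G.sub_mem hg₁ hg₂, ?_, fun i hi => ?_, fun m hm i hi => ?_⟩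
  · refine finite_support_of_forall_Icc (a := -a - 1 - n₀) (b := a + n₀) fun i hi => ?_
    rw [Set.mem_Icc, not_and_or, not_le, not_le] at hi
    rcases hi with hi | hi
    · simp [hl' i hi.le]
    · simp [hr i hi, hr' i (by omega)]
  · rw [Set.mem_Icc] at hi
    simp [hl i hi.2, hr' i (by omega)]
  · rw [Set.mem_Icc, not_and_or, not_le, not_le] at hi
    rcases hi with hi | hi
    · by_cases hi' : i ≤ -a - 1 - n₀
      · simp [hl' i hi']
      · have h1 : ∀ j : ℤ, j < -a → m • g₁ j = 0 := fun j hj => by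
          rw [hl j (by omega)]
          exact hm j (by simp [hj])
        simp [smul_sub, h1 i hi, ho' m (fun j _ hj => h1 j (by omega)) i (by omega)]
    · simp [ho m (fun j hj _ => hm j (by simp [hj])) i hi, hr' i (by omega)]

/-- A finitely supported element of `G` that is divisible by `m` in `G` is `m` times a finitely
supported element of `G`. -/
theorem IsOrderControllable.exists_finite_support_smul (hG : IsGroupShift G)
    (hoc : IsOrderControllable G) {x y : ℤ → H} (hx : (support x).Finite) (hy : y ∈ G) {m : ℕ}
    (hxy : x = m • y) : ∃ z ∈ G, (support z).Finite ∧ x = m • z := by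
  obtain ⟨a, ha⟩ := exists_window hx
  obtain ⟨z, hz, hzf, hzy, hzm⟩ := hoc.exists_finite_support hG hy a
  refine ⟨z, hz, hzf, funext fun i => ?_⟩
  have hxi : x i = m • y i := congrFun hxy i
  by_cases hi : i ∈ Set.Icc (-a : ℤ) a
  · rw [Pi.smul_apply, hzy i hi, hxi]
  · rw [Pi.smul_apply, hzm m (fun j hj => by rw [← ha j hj, hxy, Pi.smul_apply]) i hi, ha i hi]

/-- If `x ∈ G` is finitely supported and `x` minus a translate of `x` lies in `m G`, then `x` lies
in `m G`. -/
theorem IsGroupShift.exists_eq_smul [Finite H] [DiscreteTopology H] (hG : IsGroupShift G)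
    {x y : ℤ → H} (hx : (support x).Finite)
    (hy : y ∈ G) {m P : ℕ} (hP : 0 < P) (hxy : shiftPow (-P) x - x = m • y) :
    ∃ z ∈ G, x = m • z := by
  have hcl : IsClosed ((fun z : ℤ → H => m • z) '' G) :=
    (hG.1.isCompact.image (by fun_prop)).isClosed
  have hiter : ∀ n : ℕ, ∃ z ∈ G, shiftPow (-(n * P : ℤ)) x - x = m • z := by
    intro n
    induction n with
    | zero => exact ⟨0, G.zero_mem, by simp [shiftPow_zero]⟩
    | succ n ih =>
      obtain ⟨z, hz, h⟩ := ih
      refine ⟨shiftPow (-P) z + y, G.add_mem (hG.shiftPow_mem _ hz) hy, ?_⟩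
      rw [smul_add, ← hxy]
      have h1 : m • shiftPow (-P : ℤ) z = shiftPow (-P : ℤ) (m • z) := rfl
      rw [h1, ← h]
      have h2 : shiftPow (-P : ℤ) (shiftPow (-(n * P : ℤ)) x - x) =
          shiftPow (-P : ℤ) (shiftPow (-(n * P : ℤ)) x) - shiftPow (-P : ℤ) x := rfl
      rw [h2, shiftPow_shiftPow]
      have h3 : (-P + -(n * P) : ℤ) = -((n + 1 : ℕ) * P) := by push_cast; ring
      rw [h3]
      abel
  obtain ⟨z, hz, h⟩ : x ∈ (fun z : ℤ → H => m • z) '' G := by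
    refine mem_closed_of_agree hcl fun n => ?_
    obtain ⟨a, ha⟩ := (hx.image Int.natAbs).bddAbove
    obtain ⟨z, hz, h⟩ := hiter (n + a + 1)
    refine ⟨m • -z, ⟨-z, G.neg_mem hz, rfl⟩, fun i hi => ?_⟩
    rw [smul_neg, ← h, neg_sub, Pi.sub_apply, sub_eq_self]
    by_contra hxi
    have h1 := ha ⟨_, hxi, rfl⟩
    have h2 : (n + a + 1 : ℤ) ≤ (n + a + 1 : ℕ) * P := by
      push_cast
      exact le_mul_of_one_le_right (by positivity) (by exact_mod_cast hP)
    rw [Set.mem_Icc] at hi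
    omega
  exact ⟨z, hz, h.symm⟩

/-- The finitely supported elements of a group shift, as a `ℤ[T;T⁻¹]`-module. -/
noncomputable def finSuppModule (hG : IsGroupShift G) : Submodule ℤ[T;T⁻¹] (ℤ →₀ H) where
  carrier := {x | ⇑x ∈ G}
  zero_mem' := G.zero_mem
  add_mem' hx hy := G.add_mem hx hy
  smul_mem' c x hx := by
    induction c using LaurentPolynomial.induction_on' with
    | add p q hp hq => exact add_smul p q x ▸ G.add_mem hp hq
    | C_mul_T n a =>
      change ⇑((C a * T n : ℤ[T;T⁻¹]) • x) ∈ G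
      rw [mul_smul, C_smul_eq_zsmul, Finsupp.coe_smul, T_smul_eq_shiftPow]
      exact G.zsmul_mem (hG.shiftPow_mem _ hx) a

theorem quotientsTorsionFree_finSuppModule [Finite H] [DiscreteTopology H]
    (hG : IsGroupShift G) (hoc : IsOrderControllable G) :
    QuotientsTorsionFree (finSuppModule hG) := by
  rintro m P ⟨x, hx⟩ ⟨y, hy⟩ hP hxy
  have hxy' : shiftPow (-P : ℤ) x - x = m • (y : ℤ → H) := by
    rw [← T_smul_eq_shiftPow, ← Finsupp.coe_sub, ← Finsupp.coe_smul]
    have := congrArg Subtype.val hxy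
    simpa [sub_smul] using congrArg DFunLike.coe this
  obtain ⟨z, hz, hxz⟩ := hG.exists_eq_smul (hx := x.hasFiniteSupport) hy hP hxy'
  obtain ⟨w, hw, hwf, hxw⟩ := hoc.exists_finite_support_smul hG x.hasFiniteSupport hz hxz
  exact ⟨⟨Finsupp.ofSupportFinite w hwf, hw⟩, Subtype.ext (DFunLike.coe_injective hxw)⟩

end Dynamics

/-- If `H` is a finite abelian group and `G` is an order controllable
group shift over `H`, then there is a finite abelian group `K` (with the discrete topology)
and a noncatastrophic isomorphic encoder `Φ : K^ℤ → G`; in particular `G` is algebraically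
and topologically conjugate to the full group shift `K^ℤ`. -/
theorem order_controllable_noncatastrophic_encoder
    {H : Type} [AddCommGroup H] [Fintype H] [TopologicalSpace H] [DiscreteTopology H]
    (G : AddSubgroup (ℤ → H)) (hG : IsGroupShift G) (hoc : IsOrderControllable G) :
    ∃ (K : Type) (_ : AddCommGroup K) (_ : TopologicalSpace K),
      Finite K ∧ DiscreteTopology K ∧ IsNoncatEncoder G K := by
  obtain ⟨K, _, hKG, hsurj, hinj⟩ := exists_finite_shiftSum_bijective (finSuppModule hG)
    (quotientsTorsionFree_finSuppModule hG hoc)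
  obtain ⟨L, hL⟩ : ∃ L : ℕ, ∀ k ∈ K, ∀ i ∉ Set.Icc (-L : ℤ) L, k i = 0 := by
    choose b hb using fun k : K => exists_window (x := (k : ℤ →₀ H)) (k : ℤ →₀ H).hasFiniteSupport
    obtain ⟨L, hL⟩ := Finite.exists_le b
    refine ⟨L, fun k hk i hi => hb ⟨k, hk⟩ i fun hi' => hi ?_⟩
    have := hL ⟨k, hk⟩
    rw [Set.mem_Icc] at hi' ⊢
    omega
  let : TopologicalSpace K := ⊥
  have : DiscreteTopology K := ⟨rfl⟩
  have hcont : Continuous (encode K L) := continuous_encode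
  have hfin : ∀ u : ℤ → K, (support u).Finite →
      encode K L u ∈ G ∧ (support (encode K L u)).Finite ∧ (encode K L u = 0 → u = 0) := by
    intro u hu
    obtain ⟨w, rfl⟩ : ∃ w : ℤ →₀ K, ⇑w = u := ⟨Finsupp.ofSupportFinite u hu, rfl⟩
    rw [encode_finsupp hL]
    refine ⟨?_, (shiftSum K w).hasFiniteSupport, fun h => ?_⟩
    · change shiftSum K w ∈ finSuppModule hG
      rw [shiftSum_apply]
      exact Submodule.sum_mem _ fun n _ => Submodule.smul_mem _ _ (hKG _ (w n).2)
    · rw [hinj w (DFunLike.coe_injective h), Finsupp.coe_zero]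
  have hsurj_fin : ∀ x ∈ G, (support x).Finite →
      ∃ u : ℤ → K, (support u).Finite ∧ encode K L u = x := by
    intro x hx hxf
    obtain ⟨w, hw⟩ := hsurj (Finsupp.ofSupportFinite x hxf) hx
    exact ⟨w, w.hasFiniteSupport, by rw [encode_finsupp hL, hw]; rfl⟩
  have hmem : ∀ u, encode K L u ∈ G := by
    intro u
    refine mem_closed_of_agree (hG.1.preimage hcont) fun n => ?_
    refine ⟨fun i => if i ∈ Set.Icc (-n : ℤ) n then u i else 0, (hfin _ ?_).1,
      fun i hi => if_pos hi⟩
    exact finite_support_of_forall_Icc fun i hi => if_neg hi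
  have hsurj_all : ∀ x ∈ G, ∃ u, encode K L u = x := by
    intro x hx
    refine mem_closed_of_agree (C := Set.range (encode K L))
      (isCompact_range hcont).isClosed fun n => ?_
    obtain ⟨g, hg, hgf, hgx, -⟩ := hoc.exists_finite_support hG hx n
    obtain ⟨u, -, hu⟩ := hsurj_fin g hg hgf
    exact ⟨g, ⟨u, hu⟩, hgx⟩
  have hinj_all := encode_injective hmem hsurj_fin fun u hu => (hfin u hu).2.2
  let Φ : (ℤ → K) ≃+ G := AddEquiv.ofBijective ((encode K L).codRestrict G hmem)
    ⟨fun u v huv => hinj_all (congrArg Subtype.val huv), fun x => by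
      obtain ⟨u, hu⟩ := hsurj_all x x.2
      exact ⟨u, Subtype.ext hu⟩⟩
  have hΦ : Continuous Φ := hcont.subtype_mk hmem
  refine ⟨K, inferInstance, inferInstance, inferInstance, inferInstance, Φ, hΦ,
    hΦ.continuous_symm_of_equiv_compact_to_t2 (f := Φ.toEquiv), fun u => encode_shiftPow 1 u, ?_⟩
  ext x
  constructor
  · rintro ⟨u, hu, rfl⟩
    exact ⟨(Φ u).2, (hfin u hu).2.1⟩
  · rintro ⟨hx, hxf⟩
    exact hsurj_fin x hx hxf
end

section
/- Let p be a prime, H a finite abelian p-group, and G an order controllable group shift over H. Then G[p] = {g ∈ G : pg = 0} is an order controllable group shift over H. -/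
open Function Topology

/-- `G[p] = {g ∈ G : p g = 0}`, as an additive subgroup of `H^ℤ`. -/
def torsionPart {H : Type*} [AddCommGroup H] (G : AddSubgroup (ℤ → H)) (p : ℕ) :
    AddSubgroup (ℤ → H) where
  carrier := {x | x ∈ G ∧ p • x = 0}
  zero_mem' := ⟨G.zero_mem, smul_zero p⟩
  add_mem' := fun ha hb => ⟨G.add_mem ha.1 hb.1, by rw [smul_add, ha.2, hb.2, add_zero]⟩
  neg_mem' := fun ha => ⟨G.neg_mem ha.1, by rw [smul_neg, ha.2, neg_zero]⟩

/-- The shift commutes with multiplication by a natural number. -/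
theorem shift_nsmul {H : Type*} [AddCommGroup H] (p : ℕ) (x : ℤ → H) :
    shift (p • x) = p • shift x := rfl

theorem shift_eq_zero_iff {H : Type*} [AddCommGroup H] (x : ℤ → H) :
    shift x = 0 ↔ x = 0 := by
  refine ⟨fun h => funext fun i => ?_, fun h => by rw [h]; rfl⟩
  simpa [shiftPow] using congrFun h (i - 1)

theorem IsGroupShift.torsionPart {H : Type*} [AddCommGroup H] [TopologicalSpace H]
    [DiscreteTopology H] {G : AddSubgroup (ℤ → H)} (hG : IsGroupShift G) (p : ℕ) :
    IsGroupShift (torsionPart G p) := by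
  refine ⟨?_, Set.Subset.antisymm ?_ ?_⟩
  · have hcont : Continuous fun x : ℤ → H => p • x :=
      continuous_pi fun i => continuous_of_discreteTopology.comp (continuous_apply i)
    exact hG.1.inter (isClosed_singleton.preimage hcont)
  · rintro _ ⟨x, ⟨hxG, hx⟩, rfl⟩
    refine ⟨?_, ?_⟩
    · have hmem : shift x ∈ shift '' (G : Set (ℤ → H)) := ⟨x, hxG, rfl⟩
      rwa [hG.2] at hmem
    · rw [← shift_nsmul, shift_eq_zero_iff, hx]
  · rintro y ⟨hyG, hy⟩
    have hmem : y ∈ shift '' (G : Set (ℤ → H)) := by rwa [hG.2]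
    obtain ⟨x, hxG, rfl⟩ := hmem
    exact ⟨x, ⟨hxG, by rwa [← shift_nsmul, shift_eq_zero_iff] at hy⟩, rfl⟩

theorem IsOrderControllable.torsionPart {H : Type*} [AddCommGroup H]
    {G : AddSubgroup (ℤ → H)} (hG : IsOrderControllable G) (p : ℕ) :
    IsOrderControllable (torsionPart G p) := by
  obtain ⟨n₀, hn₀, h⟩ := hG
  refine ⟨n₀, hn₀, fun g hg => ?_⟩
  obtain ⟨g₁, hg₁, hpast, hfuture, hord⟩ := h g hg.1
  have hgp : ∀ i, p • g i = 0 := fun i => congrFun hg.2 i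
  have hwindow : p • (fun j : Fin n₀ => g₁ ((j : ℤ) + 1)) = 0 :=
    addOrderOf_dvd_iff_nsmul_eq_zero.1
      (hord.trans (addOrderOf_dvd_of_nsmul_eq_zero (funext fun j => hgp _)))
  refine ⟨g₁, ⟨hg₁, funext fun i => ?_⟩, hpast, hfuture, hord⟩
  change p • g₁ i = 0
  rcases le_or_gt i 0 with hi | hi
  · rw [hpast i hi, hgp]
  rcases lt_or_ge (n₀ : ℤ) i with hi' | hi'
  · rw [hfuture i hi', smul_zero]
  have hj := congrFun hwindow ⟨(i - 1).toNat, by omega⟩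
  have hcast : ((i - 1).toNat : ℤ) + 1 = i := by omega
  simpa only [Pi.smul_apply, Pi.zero_apply, hcast] using hj

/-- If `p` is a prime, `H` a finite abelian `p`-group and `G` an order
controllable group shift over `H`, then `G[p]` is an order controllable group shift. -/
theorem torsionPart_orderControllable
    (p : ℕ) (hp : p.Prime)
    {H : Type} [AddCommGroup H] [Fintype H] [TopologicalSpace H] [DiscreteTopology H]
    (hH : ∃ n : ℕ, Fintype.card H = p ^ n)
    (G : AddSubgroup (ℤ → H)) (hG : IsGroupShift G) (hoc : IsOrderControllable G) :
    IsGroupShift (torsionPart G p) ∧ IsOrderControllable (torsionPart G p) :=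
  ⟨hG.torsionPart p, hoc.torsionPart p⟩
end

section
/- Let p be a prime, H a finite abelian p-group, and G an order controllable group shift over H. Then for every nonnegative integer r with p^r < exp(H), the subgroup p^r G = {p^r g : g ∈ G} is an order controllable group shift over H. -/
open Function Topology

/-- The subgroup `k·G = {k g : g ∈ G}` of `H^ℤ`. -/
def smulSubgroup {H : Type*} [AddCommGroup H] (k : ℕ) (G : AddSubgroup (ℤ → H)) :
    AddSubgroup (ℤ → H) :=
  G.map (zsmulAddGroupHom (k : ℤ))

theorem IsGroupShift.smulSubgroup {H : Type*} [AddCommGroup H] [Finite H] [TopologicalSpace H]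
    [DiscreteTopology H] {G : AddSubgroup (ℤ → H)} (hG : IsGroupShift G) (k : ℕ) :
    IsGroupShift (smulSubgroup k G) := by
  obtain ⟨hclosed, hshift⟩ := hG
  refine ⟨?_, ?_⟩
  · have hcont : Continuous (fun x : ℤ → H => (k : ℤ) • x) :=
      continuous_pi fun i => continuous_of_discreteTopology.comp (continuous_apply i)
    exact (hclosed.isCompact.image hcont).isClosed
  · change shift '' ((fun x : ℤ → H => (k : ℤ) • x) '' (G : Set (ℤ → H))) =
      (fun x : ℤ → H => (k : ℤ) • x) '' (G : Set (ℤ → H))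
    conv_rhs => rw [← hshift]
    rw [Set.image_image, Set.image_image]
    rfl

theorem addOrderOf_nsmul_dvd_of_dvd {A : Type*} [AddMonoid A] {x y : A}
    (h : addOrderOf x ∣ addOrderOf y) (k : ℕ) : addOrderOf (k • x) ∣ addOrderOf (k • y) := by
  rw [addOrderOf_dvd_iff_nsmul_eq_zero, ← mul_nsmul, ← addOrderOf_dvd_iff_nsmul_eq_zero]
  refine h.trans ?_
  rw [addOrderOf_dvd_iff_nsmul_eq_zero, mul_nsmul, addOrderOf_nsmul_eq_zero]

theorem IsOrderControllable.smulSubgroup {H : Type*} [AddCommGroup H] {G : AddSubgroup (ℤ → H)}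
    (hG : IsOrderControllable G) (k : ℕ) : IsOrderControllable (smulSubgroup k G) := by
  obtain ⟨n₀, hn₀, hctrl⟩ := hG
  refine ⟨n₀, hn₀, ?_⟩
  rintro _ ⟨g, hg, rfl⟩
  obtain ⟨g₁, hg₁, hpast, hfuture, hord⟩ := hctrl g hg
  refine ⟨(k : ℤ) • g₁, ⟨g₁, hg₁, rfl⟩, fun i hi => ?_, fun i hi => ?_, ?_⟩
  · simp [hpast i hi]
  · simp [hfuture i hi]
  · simpa [Pi.smul_def] using addOrderOf_nsmul_dvd_of_dvd hord k

/-- If `p` is a prime, `H` a finite abelian `p`-group and `G` an order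
controllable group shift over `H`, then for every `r` with `p^r < exp(H)` the subgroup
`p^r G` is an order controllable group shift. -/
theorem smul_orderControllable
    (p : ℕ) (hp : p.Prime)
    {H : Type} [AddCommGroup H] [Fintype H] [TopologicalSpace H] [DiscreteTopology H]
    (hH : ∃ n : ℕ, Fintype.card H = p ^ n)
    (G : AddSubgroup (ℤ → H)) (hG : IsGroupShift G) (hoc : IsOrderControllable G)
    (r : ℕ) (hr : p ^ r < AddMonoid.exponent H) :
    IsGroupShift (smulSubgroup (p ^ r) G) ∧ IsOrderControllable (smulSubgroup (p ^ r) G) :=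
  ⟨hG.smulSubgroup _, hoc.smulSubgroup _⟩
end

section
/- Let p be a prime, H a finite abelian p-group, and G an order controllable group shift over H. Then for every nonnegative integer r with p^r < exp(H), one has (p^r G)_f = p^r (G_f); that is, the finitely supported elements of p^r G are exactly the elements p^r x with x a finitely supported element of G. -/
open Function Topology

/-- A group shift is invariant under every power of the shift. -/
theorem IsGroupShift.shiftPow_mem_s6 {H : Type*} [AddCommGroup H] [TopologicalSpace H]
    {G : AddSubgroup (ℤ → H)} (hG : IsGroupShift G) {g : ℤ → H} (hg : g ∈ G) (n : ℤ) :
    shiftPow n g ∈ G := by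
  induction n with
  | zero =>
    have h : shiftPow 0 g = g := funext fun i => by simp [shiftPow]
    rwa [h]
  | succ n ih =>
    have h : shift (shiftPow n g) ∈ (G : Set (ℤ → H)) := hG.2 ▸ ⟨_, ih, rfl⟩
    suffices e : shiftPow ((n : ℤ) + 1) g = shift (shiftPow n g) by rwa [e]
    funext i
    simp only [shiftPow]
    congr 1
    ring
  | pred n ih =>
    have h : shiftPow (-(n : ℤ)) g ∈ shift '' (G : Set (ℤ → H)) := by rw [hG.2]; exact ih
    obtain ⟨u, hu, hug⟩ := h
    suffices e : shiftPow (-(n : ℤ) - 1) g = u by rwa [e]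
    funext i
    have h := congrFun hug (i - 1)
    simp only [shiftPow, sub_add_cancel] at h
    rw [h]
    simp only [shiftPow]
    congr 1
    ring

/-- In an order controllable group shift, every `g` with `k • g` vanishing on the window
`(N, N + n₀]` can be truncated to the right of the window, with `k` still annihilating the
window. -/
theorem IsOrderControllable.exists_truncation {H : Type*} [AddCommGroup H] [TopologicalSpace H]
    {G : AddSubgroup (ℤ → H)} (hG : IsGroupShift G) (hoc : IsOrderControllable G) :
    ∃ n₀ : ℕ, ∀ (k : ℕ) (N : ℤ), ∀ g ∈ G, (∀ i, N < i → i ≤ N + n₀ → k • g i = 0) →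
      ∃ g₁ ∈ G, (∀ i ≤ N, g₁ i = g i) ∧ (∀ i, N + n₀ < i → g₁ i = 0) ∧
        ∀ i, N < i → k • g₁ i = 0 := by
  obtain ⟨n₀, -, h⟩ := hoc
  refine ⟨n₀, fun k N g hg hk => ?_⟩
  obtain ⟨u, hu, hle, hgt, hord⟩ := h _ (hG.shiftPow_mem_s6 hg N)
  have hwin : k • (fun j : Fin n₀ => u ((j : ℤ) + 1)) = 0 := by
    refine addOrderOf_dvd_iff_nsmul_eq_zero.1 (hord.trans ?_)
    refine addOrderOf_dvd_iff_nsmul_eq_zero.2 (funext fun j => ?_)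
    have hj := j.2
    exact hk _ (by omega) (by omega)
  refine ⟨shiftPow (-N) u, hG.shiftPow_mem_s6 hu _, fun i hi => ?_, fun i hi => ?_, fun i hi => ?_⟩
  · simp [shiftPow, hle (i + -N) (by omega)]
  · exact hgt _ (by omega)
  · rcases le_or_gt i (N + n₀) with hi' | hi'
    · have h := congrFun hwin ⟨(i - N - 1).toNat, by omega⟩
      have e : (((i - N - 1).toNat : ℕ) : ℤ) + 1 = i + -N := by omega
      rw [Pi.smul_apply, e] at h
      exact h
    · simp [shiftPow, hgt (i + -N) (by omega)]

/-- If `p` is a prime, `H` a finite abelian `p`-group and `G` an order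
controllable group shift over `H`, then for every `r` with `p^r < exp(H)` one has
`(p^r G)_f = p^r (G_f)`. -/
theorem smul_finSupp_eq
    (p : ℕ) (hp : p.Prime)
    {H : Type} [AddCommGroup H] [Fintype H] [TopologicalSpace H] [DiscreteTopology H]
    (hH : ∃ n : ℕ, Fintype.card H = p ^ n)
    (G : AddSubgroup (ℤ → H)) (hG : IsGroupShift G) (hoc : IsOrderControllable G)
    (r : ℕ) (hr : p ^ r < AddMonoid.exponent H) :
    finSupp (smulSubgroup (p ^ r) G) = (fun x : ℤ → H => (p ^ r : ℕ) • x) '' finSupp G := by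
  obtain ⟨n₀, htr⟩ := hoc.exists_truncation hG
  ext y
  constructor
  · rintro ⟨⟨g, hg, hgy⟩, hfin⟩
    have hy : ∀ i, p ^ r • g i = y i := fun i => by
      rw [← hgy]
      simp [← natCast_zsmul]
    obtain ⟨a, ha⟩ := hfin.bddBelow
    obtain ⟨b, hb⟩ := hfin.bddAbove
    have hlo : ∀ i < a, y i = 0 := fun i hi => by
      by_contra h
      exact absurd (ha h) (by omega)
    have hhi : ∀ i, b < i → y i = 0 := fun i hi => by
      by_contra h
      exact absurd (hb h) (by omega)
    obtain ⟨u, hu, hu1, hu2, hu3⟩ := htr (p ^ r) b g hg fun i hi _ => by rw [hy, hhi i hi]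
    obtain ⟨v, hv, hv1, hv2, hv3⟩ := htr (p ^ r) (min a b - 1 - n₀) g hg
      fun i _ hi => by rw [hy, hlo i (by omega)]
    refine ⟨u - v, ⟨G.sub_mem hu hv, ?_⟩, funext fun i => ?_⟩
    · refine (Set.finite_Icc (min a b - n₀) (b + n₀)).subset fun i hi => ?_
      by_contra h
      refine hi ?_
      rw [Set.mem_Icc, not_and_or, not_le, not_le] at h
      rcases h with h | h
      · simp [hu1 i (by omega), hv1 i (by omega)]
      · simp [hu2 i h, hv2 i (by omega)]
    · have hui : p ^ r • u i = y i := by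
        rcases le_or_gt i b with h | h
        · rw [hu1 i h, hy]
        · rw [hu3 i h, hhi i h]
      have hvi : p ^ r • v i = 0 := by
        rcases le_or_gt i (min a b - 1 - n₀) with h | h
        · rw [hv1 i h, hy, hlo i (by omega)]
        · exact hv3 i h
      simp [smul_sub, hui, hvi]
  · rintro ⟨x, ⟨hx, hfin⟩, rfl⟩
    refine ⟨⟨x, hx, by simp [← natCast_zsmul]⟩, hfin.subset fun i hi h => hi ?_⟩
    simp [h]
end

section
/- Let p be a prime and H a finite abelian group of exponent p (i.e., pH = 0), so that H is a vector space over the field 𝔽_p. Let G be a weakly controllable group shift over H which is of finite type. Then there exist m ∈ ℕ, N ∈ ℕ, and elements x₁,…,x_m ∈ G_f with supp(x_j) ⊆ [0,N] for all j, such that: (i) {x_j(0) : 1 ≤ j ≤ m} is an 𝔽_p-basis of the subgroup {g(0) : g ∈ G, supp(g) ⊆ [0,∞)} of H; and (ii) the set of nonzero restrictions {σⁿ(x_j)|_{[0,N]} : n ∈ ℤ, 1 ≤ j ≤ m, σⁿ(x_j)|_{[0,N]} ≠ 0} is 𝔽_p-linearly independent in H^{[0,N]}. -/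
open Function Topology

/-- `G` is weakly controllable: `G_f` is dense in `G`. -/
def IsWeaklyControllable {H : Type*} [AddCommGroup H] [TopologicalSpace H]
    (G : AddSubgroup (ℤ → H)) : Prop :=
  (G : Set (ℤ → H)) ⊆ closure (finSupp G)

/-- `G` is a shift of finite type: there is `N` such that whenever two elements of `G`
agree on a block `[k, k+N]`, they can be glued along this block inside `G`. -/
def IsFiniteType {H : Type*} [AddCommGroup H] (G : AddSubgroup (ℤ → H)) : Prop :=
  ∃ N : ℕ, ∀ x₁ ∈ G, ∀ x₂ ∈ G, ∀ k : ℤ,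
    (∀ i : ℤ, k ≤ i → i ≤ k + N → x₁ i = x₂ i) →
    ∃ x ∈ G, (∀ i : ℤ, i ≤ k + N → x i = x₁ i) ∧ (∀ i : ℤ, k ≤ i → x i = x₂ i)

/-- Linear independence over `ℤ/pℤ` of a set `S` of `p`-torsion elements of an abelian
group, phrased with integer coefficients: any vanishing integral linear combination of
elements of `S` has all its coefficients divisible by `p`. -/
def LinIndepModP (p : ℕ) {V : Type*} [AddCommGroup V] (S : Set V) : Prop :=
  ∀ t : Finset V, ↑t ⊆ S → ∀ c : V → ℤ, ∑ s ∈ t, c s • s = 0 → ∀ s ∈ t, (p : ℤ) ∣ c s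

section MinimalBasis

variable {K H ι : Type*} [Field K] [AddCommGroup H] [Module K H]

/-- The submodule of sequences vanishing outside `[a, b]`. -/
def supportedIn (K H : Type*) [Field K] [AddCommGroup H] [Module K H] (a b : ℤ) :
    Submodule K (ℤ → H) where
  carrier := {f | ∀ i, i < a ∨ b < i → f i = 0}
  zero_mem' := fun _ _ => rfl
  add_mem' := fun {f g} hf hg i hi => by simp [hf i hi, hg i hi]
  smul_mem' := fun c f hf i hi => by simp [hf i hi]

/-- The values at `0` of the elements of `G` supported in `[0, n]`. -/
def initialValues (G : Submodule K (ℤ → H)) (n : ℕ) : Submodule K H :=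
  (G ⊓ supportedIn K H 0 n).map (LinearMap.proj 0)

lemma mem_initialValues {G : Submodule K (ℤ → H)} {n : ℕ} {a : H} :
    a ∈ initialValues G n ↔ ∃ g ∈ G, (∀ i : ℤ, i < 0 ∨ (n : ℤ) < i → g i = 0) ∧ g 0 = a := by
  simp only [initialValues, Submodule.mem_map, Submodule.mem_inf, and_assoc, LinearMap.coe_proj,
    Function.eval]
  rfl

lemma initialValues_mono (G : Submodule K (ℤ → H)) : Monotone (initialValues G) := by
  intro m n hmn a ha
  obtain ⟨g, hg, hs, rfl⟩ := mem_initialValues.1 ha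
  exact mem_initialValues.2 ⟨g, hg, fun i hi => hs i (by omega), rfl⟩

/-- A monotone sequence of subspaces of a Noetherian space has an adapted linearly
independent set. -/
lemma exists_linearIndepOn_adapted [IsNoetherian K H] (L : ℕ → Submodule K H)
    (hL : Monotone L) :
    ∃ B : Set H, LinearIndepOn K id B ∧ (∃ n, B ⊆ L n) ∧
      ∀ k, L k ≤ Submodule.span K (B ∩ L k) := by
  have step : ∀ n, ∃ B : Set H, LinearIndepOn K id B ∧ B ⊆ L n ∧
      ∀ k ≤ n, L k ≤ Submodule.span K (B ∩ L k) := by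
    intro n
    induction n with
    | zero =>
      obtain ⟨B, hBL, -, hsp, hB⟩ := exists_linearIndepOn_id_extension
        (linearIndepOn_empty K (id : H → H)) (Set.empty_subset (L 0 : Set H))
      refine ⟨B, hB, hBL, fun k hk => ?_⟩
      obtain rfl : k = 0 := by omega
      rwa [Set.inter_eq_left.2 hBL]
    | succ n ih =>
      obtain ⟨B, hB, hBL, hsp⟩ := ih
      obtain ⟨B', hBL', hBB', hsp', hB'⟩ := exists_linearIndepOn_id_extension hB
        (hBL.trans (hL n.le_succ) : B ⊆ (L (n + 1) : Set H))
      refine ⟨B', hB', hBL', fun k hk => ?_⟩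
      rcases Nat.le_succ_iff.1 hk with hk | rfl
      · exact (hsp k hk).trans (Submodule.span_mono (Set.inter_subset_inter_left _ hBB'))
      · rwa [Set.inter_eq_left.2 hBL']
  obtain ⟨n, hn⟩ := monotone_stabilizes_iff_noetherian.2 ‹_› ⟨L, hL⟩
  obtain ⟨B, hB, hBL, hsp⟩ := step n
  refine ⟨B, hB, ⟨n, hBL⟩, fun k => ?_⟩
  rcases le_total k n with hk | hk
  · exact hsp k hk
  · have : L n = L k := hn k hk
    exact this ▸ hsp n le_rfl

/-- All the translates of a family of sequences. -/
def translates (x : ι → ℤ → H) (s : ℤ × ι) : ℤ → H := shiftPow s.1 (x s.2)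

/-- The translates of the `x j` that fit in `[a, b]`, where `x j` is supported in `[0, e j]`. -/
def fitting (e : ι → ℕ) (a b : ℤ) : Set (ℤ × ι) := {s | a ≤ -s.1 ∧ e s.2 - s.1 ≤ b}

lemma linearIndependent_translates [Fintype ι] (x : ι → ℤ → H)
    (hx : ∀ j, ∀ i < 0, x j i = 0) (hli : LinearIndependent K fun j => x j 0) :
    LinearIndependent K (translates x) := by
  classical
  rw [linearIndependent_iff]
  intro l hl
  by_contra hne
  obtain ⟨s, hs, hmax⟩ := l.support.exists_max_image Prod.fst (Finsupp.support_nonempty_iff.2 hne)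
  have h0 : ∑ j, l (s.1, j) • x j 0 = 0 := by
    have h := congrFun hl (-s.1)
    rw [Finsupp.linearCombination_apply, Finsupp.sum_of_support_subset l
      (s := l.support.image Prod.fst ×ˢ Finset.univ)
      (fun t ht => by
        rw [Finset.mem_product]
        exact ⟨Finset.mem_image_of_mem _ ht, Finset.mem_univ _⟩) _ (by simp),
      Finset.sum_product, Finset.sum_apply, Finset.sum_eq_single s.1] at h
    · simpa [translates, shiftPow] using h
    · intro k _ hk
      rw [Finset.sum_apply]
      refine Finset.sum_eq_zero fun j _ => ?_
      by_cases hlk : l (k, j) = 0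
      · simp [hlk]
      · have hks : k ≤ s.1 := hmax _ (Finsupp.mem_support_iff.2 hlk)
        have hz : translates x (k, j) (-s.1) = 0 := hx j _ (by dsimp only; omega)
        simp [hz]
    · intro h'
      exact absurd (Finset.mem_image_of_mem _ hs) h'
  exact Finsupp.mem_support_iff.1 hs (Fintype.linearIndependent_iff.1 hli _ h0 s.2)

lemma mem_span_fitting (G : Submodule K (ℤ → H)) (hG : ∀ n : ℤ, ∀ g ∈ G, shiftPow n g ∈ G)
    (x : ι → ℤ → H) (e : ι → ℕ) (hxG : ∀ j, x j ∈ G)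
    (hx : ∀ j, ∀ i : ℤ, i < 0 ∨ (e j : ℤ) < i → x j i = 0)
    (hsp : ∀ n, initialValues G n ≤ Submodule.span K ((fun j => x j 0) '' {j | e j ≤ n}))
    (n : ℕ) (a : ℤ) (y : ℤ → H) (hy : y ∈ G) (hya : ∀ i, i < a ∨ a + n ≤ i → y i = 0) :
    y ∈ Submodule.span K (translates x '' fitting e a (a + n - 1)) := by
  induction n generalizing a y with
  | zero =>
    have : y = 0 := funext fun i => hya i (by omega)
    simp [this]
  | succ n ih =>
    set S := Submodule.span K (translates x '' fitting e a (a + (n + 1 : ℕ) - 1)) with hS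
    have hSG : S ≤ G ⊓ supportedIn K H a (a + n) := by
      rw [hS, Submodule.span_le]
      rintro _ ⟨⟨k, j⟩, ⟨h1, h2⟩, rfl⟩
      refine ⟨hG _ _ (hxG j), fun i hi => hx j _ ?_⟩
      dsimp only at h1 h2 ⊢
      push_cast at h2
      omega
    have hval : initialValues G n ≤ S.map (LinearMap.proj a) := by
      refine (hsp n).trans (Submodule.span_le.2 ?_)
      rintro _ ⟨j, hj, rfl⟩
      refine ⟨translates x (-a, j), Submodule.subset_span ⟨_, ?_, rfl⟩, ?_⟩
      · have hj' : e j ≤ n := hj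
        exact ⟨by simp, by push_cast; omega⟩
      · simp [translates, shiftPow]
    have hya0 : y a ∈ initialValues G n := by
      refine mem_initialValues.2 ⟨shiftPow a y, hG a y hy, fun i hi => hya _ ?_, ?_⟩
      · push_cast
        omega
      · simp [shiftPow]
    obtain ⟨s, hs, hsa⟩ := hval hya0
    have hrest := ih (a + 1) (y - s) (G.sub_mem hy (hSG hs).1) fun i hi => by
      rcases eq_or_ne i a with rfl | hia
      · simpa [sub_eq_zero] using hsa.symm
      · have h1 : y i = 0 := hya i (by push_cast; omega)
        have h2 : s i = 0 := (hSG hs).2 i (by omega)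
        simp [h1, h2]
    have hle : fitting e (a + 1) (a + 1 + n - 1) ⊆ fitting e a (a + (n + 1 : ℕ) - 1) := by
      rintro t ⟨h1, h2⟩
      constructor <;> push_cast <;> omega
    simpa using S.add_mem (Submodule.span_mono (Set.image_mono hle) hrest) hs

lemma mem_span_fitting_of_finite_support (G : Submodule K (ℤ → H))
    (hG : ∀ n : ℤ, ∀ g ∈ G, shiftPow n g ∈ G)
    (x : ι → ℤ → H) (e : ι → ℕ) (hxG : ∀ j, x j ∈ G)
    (hx : ∀ j, ∀ i : ℤ, i < 0 ∨ (e j : ℤ) < i → x j i = 0)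
    (hsp : ∀ n, initialValues G n ≤ Submodule.span K ((fun j => x j 0) '' {j | e j ≤ n}))
    (a b : ℤ) (y : ℤ → H) (hy : y ∈ G) (hya : ∀ i, i < a ∨ b < i → y i = 0) :
    y ∈ Submodule.span K (translates x '' fitting e a b) := by
  rcases le_or_gt a b with hab | hab
  · have h := mem_span_fitting G hG x e hxG hx hsp (b + 1 - a).toNat a y hy
      fun i hi => hya i (by omega)
    rwa [show a + ((b + 1 - a).toNat : ℤ) - 1 = b by omega] at h
  · have : y = 0 := funext fun i => hya i (by omega)
    simp [this]

/-- Restriction of a sequence to the window `[0, N]`. -/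
def window (K H : Type*) [Field K] [AddCommGroup H] [Module K H] (N : ℕ) :
    (ℤ → H) →ₗ[K] (Fin (N + 1) → H) :=
  LinearMap.funLeft K H fun i : Fin (N + 1) => (i : ℤ)

lemma window_eq_zero_iff {N : ℕ} {y : ℤ → H} :
    window K H N y = 0 ↔ ∀ i : ℤ, 0 ≤ i → i ≤ N → y i = 0 := by
  constructor
  · intro h i h0 h1
    have := congrFun h ⟨i.toNat, by omega⟩
    simpa [window, LinearMap.funLeft_apply, Int.toNat_of_nonneg h0] using this
  · intro h
    ext i
    exact h i (by omega) (by have := i.2; omega)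

lemma exists_bound_of_finite_support {y : ℤ → H} (hy : (Function.support y).Finite) :
    ∃ b : ℕ, ∀ i : ℤ, i < -b ∨ (b : ℤ) < i → y i = 0 := by
  obtain ⟨b, hb⟩ := (hy.image Int.natAbs).bddAbove
  refine ⟨b, fun i hi => ?_⟩
  by_contra h
  have := hb (Set.mem_image_of_mem _ h)
  omega

lemma linearIndepOn_window_translates [Fintype ι] (G : Submodule K (ℤ → H))
    (hG : ∀ n : ℤ, ∀ g ∈ G, shiftPow n g ∈ G)
    (x : ι → ℤ → H) (e : ι → ℕ) (hxG : ∀ j, x j ∈ G)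
    (hx : ∀ j, ∀ i : ℤ, i < 0 ∨ (e j : ℤ) < i → x j i = 0)
    (hsp : ∀ n, initialValues G n ≤ Submodule.span K ((fun j => x j 0) '' {j | e j ≤ n}))
    (hli : LinearIndependent K fun j => x j 0) (N : ℕ)
    (hsplit : ∀ y ∈ G, (∀ i : ℤ, 0 ≤ i → i ≤ N → y i = 0) →
      ∃ z ∈ G, (∀ i < 0, z i = y i) ∧ ∀ i, 0 ≤ i → z i = 0) :
    LinearIndepOn K (fun s => window K H N (translates x s))
      {s | window K H N (translates x s) ≠ 0} := by
  have hu := linearIndependent_translates (K := K) x (fun j i hi => hx j i (Or.inl hi)) hli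
  set I := {s | window K H N (translates x s) ≠ 0} with hI
  refine (hu.linearIndepOn (s := I)).map (f := window K H N) ?_
  rw [← Set.image_eq_range, Submodule.disjoint_def]
  intro y hyI hy0
  have hy0' := window_eq_zero_iff.1 (LinearMap.mem_ker.1 hy0)
  have hyG : y ∈ G := by
    refine (Submodule.span_le.2 ?_ : Submodule.span K (translates x '' I) ≤ G) hyI
    rintro _ ⟨s, -, rfl⟩
    exact hG _ _ (hxG _)
  have hyb : ∃ b : ℕ, ∀ i : ℤ, i < -b ∨ (b : ℤ) < i → y i = 0 := by
    clear hy0 hy0' hyG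
    induction hyI using Submodule.span_induction with
    | mem y hy =>
      obtain ⟨⟨k, j⟩, -, rfl⟩ := hy
      exact ⟨k.natAbs + e j, fun i hi => hx j _ (by dsimp only; omega)⟩
    | zero => exact ⟨0, fun _ _ => rfl⟩
    | add y z _ _ ihy ihz =>
      obtain ⟨b, hb⟩ := ihy
      obtain ⟨c, hc⟩ := ihz
      refine ⟨max b c, fun i hi => ?_⟩
      rw [Pi.add_apply, hb i (by omega), hc i (by omega), add_zero]
    | smul r y _ ihy =>
      obtain ⟨b, hb⟩ := ihy
      exact ⟨b, fun i hi => by rw [Pi.smul_apply, hb i hi, smul_zero]⟩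
  obtain ⟨b, hb⟩ := hyb
  obtain ⟨z, hzG, hz1, hz2⟩ := hsplit y hyG hy0'
  have hfit := mem_span_fitting_of_finite_support G hG x e hxG hx hsp
  have hz := hfit (-b) (-1) z hzG fun i hi => by
    rcases hi with hi | hi
    · rw [hz1 i (by omega), hb i (Or.inl hi)]
    · exact hz2 i (by omega)
  have hw := hfit (N + 1) b (y - z) (G.sub_mem hyG hzG) fun i hi => by
    rcases lt_or_ge i 0 with h0 | h0
    · simp [hz1 i h0]
    · rcases hi with hi | hi
      · simp [hz2 i h0, hy0' i h0 (by omega)]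
      · simp [hz2 i h0, hb i (Or.inr hi)]
  have hsub : ∀ a c : ℤ, (c < 0 ∨ (N : ℤ) < a) → fitting e a c ⊆ Iᶜ := by
    rintro a c hac ⟨k, j⟩ ⟨h1, h2⟩ h
    refine h (window_eq_zero_iff.2 fun i h0 hN => hx j _ ?_)
    dsimp only at h1 h2 ⊢
    omega
  have hyJ : y ∈ Submodule.span K (translates x '' Iᶜ) := by
    have := Submodule.add_mem _
      (Submodule.span_mono (Set.image_mono (hsub _ _ (Or.inl (by omega)))) hz)
      (Submodule.span_mono (Set.image_mono (hsub _ _ (Or.inr (by omega)))) hw)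
    simpa using this
  exact Submodule.disjoint_def.1 (hu.disjoint_span_image disjoint_compl_right) y hyI hyJ

end MinimalBasis

lemma shiftPow_mem_of_image_shift {H : Type*} [AddCommGroup H] {G : AddSubgroup (ℤ → H)}
    (hG : shift '' (G : Set (ℤ → H)) = (G : Set (ℤ → H))) (n : ℤ) :
    ∀ g ∈ G, shiftPow n g ∈ G := by
  induction n using Int.induction_on with
  | zero =>
    intro g hg
    have h' : shiftPow 0 g = g := funext fun i => congrArg g (add_zero i)
    exact h'.symm ▸ hg
  | succ n ih =>
    intro g hg
    have h : shift (shiftPow n g) ∈ (G : Set (ℤ → H)) := hG ▸ Set.mem_image_of_mem _ (ih g hg)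
    have h' : shift (shiftPow n g) = shiftPow (n + 1) g :=
      funext fun i => congrArg g (by ring)
    exact h' ▸ h
  | pred n ih =>
    intro g hg
    obtain ⟨f, hf, rfl⟩ : g ∈ shift '' (G : Set (ℤ → H)) := hG.symm ▸ hg
    have h' : shiftPow (-n - 1) (shift f) = shiftPow (-n) f :=
      funext fun i => congrArg f (by ring)
    exact h' ▸ ih f hf

lemma exists_finSupp_eqOn {H : Type*} [AddCommGroup H] [TopologicalSpace H] [DiscreteTopology H]
    {G : AddSubgroup (ℤ → H)} (hwc : IsWeaklyControllable G) {g : ℤ → H} (hg : g ∈ G)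
    (F : Finset ℤ) : ∃ h ∈ finSupp G, ∀ i ∈ F, h i = g i := by
  obtain ⟨h, hF, hh⟩ := mem_closure_iff.1 (hwc hg) (Set.pi F fun i => {g i})
    (isOpen_set_pi F.finite_toSet fun i _ => isOpen_discrete _) fun i _ => rfl
  exact ⟨h, hh, fun i hi => hF i hi⟩

/-- In a weakly controllable group of finite type, an element supported in `[0, ∞)` may be
replaced by a finitely supported one without changing its value at `0`. -/
lemma exists_finite_right_support {H : Type*} [AddCommGroup H] [TopologicalSpace H]
    [DiscreteTopology H] {G : AddSubgroup (ℤ → H)} (hwc : IsWeaklyControllable G)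
    (hft : IsFiniteType G) {g : ℤ → H} (hg : g ∈ G) (hg0 : ∀ i < 0, g i = 0) :
    ∃ f ∈ G, ∃ n : ℕ, (∀ i : ℤ, i < 0 ∨ (n : ℤ) < i → f i = 0) ∧ f 0 = g 0 := by
  obtain ⟨M, hM⟩ := hft
  obtain ⟨h, ⟨hhG, hfin⟩, hh⟩ := exists_finSupp_eqOn hwc hg (Finset.Icc (-M - 1 : ℤ) 0)
  obtain ⟨n, hn⟩ := exists_bound_of_finite_support hfin
  obtain ⟨f, hf, hf1, hf2⟩ := hM 0 G.zero_mem h hhG (-M - 1) fun i h1 h2 => by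
    rw [hh i (Finset.mem_Icc.2 ⟨h1, by omega⟩), hg0 i (by omega)]
    rfl
  refine ⟨f, hf, n, fun i hi => ?_, ?_⟩
  · rcases hi with hi | hi
    · exact hf1 i (by omega)
    · rw [hf2 i (by omega), hn i (Or.inr hi)]
  · rw [hf2 0 (by omega), hh 0 (Finset.mem_Icc.2 ⟨by omega, le_rfl⟩)]

lemma LinearIndepOn.linIndepModP {p : ℕ} {V : Type*} [AddCommGroup V] [Module (ZMod p) V]
    {S : Set V} (hS : LinearIndepOn (ZMod p) id S) : LinIndepModP p S := by
  intro t ht c hc s hs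
  rw [← ZMod.intCast_zmod_eq_zero_iff_dvd]
  refine linearIndepOn_iff'.1 hS t (fun v => (c v : ZMod p)) ht ?_ s hs
  simpa [Int.cast_smul_eq_zsmul] using hc

/-- Let `p` be a prime and `H` a finite abelian group of exponent `p`.
If `G` is a weakly controllable group shift over `H` of finite type, then there exist
`m`, `N` and `x₁,…,x_m ∈ G_f` supported in `[0,N]` such that (i) `{x_j(0)}` is an
`𝔽_p`-basis of `{g(0) : g ∈ G, supp(g) ⊆ [0,∞)}`, and (ii) the nonzero restrictions
`σⁿ(x_j)|_{[0,N]}` form an `𝔽_p`-linearly independent subset of `H^{[0,N]}`. -/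
theorem exponent_p_generating_set
    (p : ℕ) (hp : p.Prime)
    {H : Type} [AddCommGroup H] [Fintype H] [TopologicalSpace H] [DiscreteTopology H]
    (hexp : ∀ a : H, p • a = 0)
    (G : AddSubgroup (ℤ → H)) (hG : IsGroupShift G)
    (hwc : IsWeaklyControllable G) (hft : IsFiniteType G) :
    ∃ (m N : ℕ) (x : Fin m → (ℤ → H)),
      (∀ j, x j ∈ finSupp G) ∧
      (∀ j, ∀ i : ℤ, i < 0 ∨ (N : ℤ) < i → x j i = 0) ∧
      -- (i) `{x_j(0)}` spans `{g(0) : g ∈ G, supp(g) ⊆ [0,∞)}` …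
      (∀ a : H, (∃ g ∈ G, (∀ i : ℤ, i < 0 → g i = 0) ∧ g 0 = a) →
        ∃ c : Fin m → ℤ, a = ∑ j, c j • x j 0) ∧
      -- … and is `𝔽_p`-linearly independent (so it is an `𝔽_p`-basis),
      (∀ c : Fin m → ℤ, ∑ j, c j • x j 0 = 0 → ∀ j, (p : ℤ) ∣ c j) ∧
      -- (ii) the nonzero restrictions to `[0,N]` are `𝔽_p`-linearly independent.
      LinIndepModP p
        {r : Fin (N + 1) → H | r ≠ 0 ∧
          ∃ (n : ℤ) (j : Fin m), r = fun i : Fin (N + 1) => shiftPow n (x j) (i : ℤ)} := by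
  have : Fact p.Prime := ⟨hp⟩
  obtain ⟨_⟩ : Nonempty (Module (ZMod p) H) := ⟨AddCommGroup.zmodModule hexp⟩
  have hshift := shiftPow_mem_of_image_shift hG.2
  obtain ⟨M, hM⟩ := id hft
  let G' : Submodule (ZMod p) (ℤ → H) := AddSubgroup.toZModSubmodule p G
  obtain ⟨B, hB, ⟨n₀, hBL⟩, hspan⟩ :=
    exists_linearIndepOn_adapted _ (initialValues_mono G')
  obtain ⟨m, ⟨b⟩⟩ := Finite.exists_equiv_fin B
  have hmin : ∀ j, ∃ n ≤ n₀, ((b.symm j : B) : H) ∈ initialValues G' n ∧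
      ∀ k, ((b.symm j : B) : H) ∈ initialValues G' k → n ≤ k := by
    classical
    intro j
    have hex : ∃ n, ((b.symm j : B) : H) ∈ initialValues G' n := ⟨n₀, hBL (b.symm j).2⟩
    exact ⟨Nat.find hex, Nat.find_min' hex (hBL (b.symm j).2), Nat.find_spec hex,
      fun k hk => Nat.find_min' hex hk⟩
  choose e he heL hek using hmin
  choose x hxG hx hx0 using fun j => mem_initialValues.1 (heL j)
  have hli : LinearIndependent (ZMod p) fun j => x j 0 := by
    simp only [hx0]
    exact LinearIndependent.comp hB b.symm b.symm.injective
  have hsp : ∀ n, initialValues G' n ≤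
      Submodule.span (ZMod p) ((fun j => x j 0) '' {j | e j ≤ n}) := by
    intro n
    refine (hspan n).trans (Submodule.span_mono ?_)
    rintro a ⟨haB, han⟩
    refine ⟨b ⟨a, haB⟩, hek _ _ ?_, ?_⟩
    · simpa using han
    · simp [hx0]
  have hxN : ∀ j, ∀ i : ℤ, i < 0 ∨ ((max M n₀ : ℕ) : ℤ) < i → x j i = 0 := fun j i hi =>
    hx j i (by have := he j; omega)
  refine ⟨m, max M n₀, x, fun j => ⟨hxG j, ?_⟩, hxN, ?_, ?_, ?_⟩
  · refine (Set.finite_Icc (0 : ℤ) (max M n₀ : ℕ)).subset fun i hi => ?_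
    by_contra h
    exact hi (hxN j i (by rw [Set.mem_Icc] at h; omega))
  · rintro a ⟨g, hg, hg0, rfl⟩
    obtain ⟨f, hf, n, hfs, hf0⟩ := exists_finite_right_support hwc hft hg hg0
    have hmem := Submodule.span_mono (Set.image_subset_range _ _)
      (hsp n (mem_initialValues.2 ⟨f, hf, hfs, hf0⟩))
    obtain ⟨c, hc⟩ := Submodule.mem_span_range_iff_exists_fun (ZMod p) |>.1 hmem
    choose d hd using fun j => ZMod.intCast_surjective (c j)
    refine ⟨d, hc.symm.trans (Finset.sum_congr rfl fun j _ => ?_)⟩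
    rw [← hd, Int.cast_smul_eq_zsmul]
  · intro c hc j
    rw [← ZMod.intCast_zmod_eq_zero_iff_dvd]
    refine Fintype.linearIndependent_iff.1 hli (fun j => (c j : ZMod p)) ?_ j
    simpa [Int.cast_smul_eq_zsmul] using hc
  · have hw := linearIndepOn_window_translates G' hshift x e hxG hx hsp hli (max M n₀) ?_
    · refine LinearIndepOn.linIndepModP (hw.id_image.mono ?_)
      rintro r ⟨hr, n, j, rfl⟩
      exact ⟨(n, j), hr, rfl⟩
    · intro y hy hy0
      obtain ⟨z, hz, hz1, hz2⟩ := hM y hy 0 G.zero_mem 0 fun i h0 h1 => hy0 i h0 (by omega)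
      exact ⟨z, hz, fun i hi => hz1 i (by omega), hz2⟩
end
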